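/- A polytope P in R^n with nonempty interior and at most m facets (m ≥ n+1) is uniquely determined up to translation among all convex bodies in R^n by its surface tensors up to rank m − n + 2. Equivalently, if K is a convex body whose surface tensors of all ranks s ≤ m − n + 2 agree with those of P, then K is a translate of P. -/

import Mathlib

open MeasureTheory Metric Real Filter
open scoped InnerProductSpace ENNReal NNReal Topology

noncomputable section

abbrev En (n : ℕ) := EuclideanSpace ℝ (Fin n)

abbrev Sph (n : ℕ) : Set (En n) := Metric.sphere 0 1

/-- `μ` is the surface area measure `S_{n-1}(K, ·)` of the convex body `K`:
for full-dimensional `K` it assigns to a Borel set `ω ⊆ S^{n-1}` the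
`(n-1)`-dimensional Hausdorff measure of the set `τ(K, ω)` of boundary points
of `K` having an outer normal in `ω`; for lower-dimensional `K` (contained in a
hyperplane with unit normal `u`) it is `S(K)(δ_u + δ_{-u})` where `S(K)` is the
`(n-1)`-dimensional Hausdorff measure of `K`. -/
def IsSurfaceAreaMeasure {n : ℕ} (K : Set (En n)) (μ : Measure (Sph n)) : Prop :=
  ((interior K).Nonempty ∧ ∀ ω : Set (Sph n), MeasurableSet ω →
      μ ω = μH[((n : ℝ) - 1)]
        {x ∈ frontier K | ∃ u ∈ ω, ∀ y ∈ K, ⟪y - x, (u : En n)⟫_ℝ ≤ 0})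
  ∨ (interior K = ∅ ∧ ∃ u u' : Sph n, (u' : En n) = -(u : En n) ∧
      (∃ c : ℝ, ∀ x ∈ K, ⟪x, (u : En n)⟫_ℝ = c) ∧
      μ = (μH[((n : ℝ) - 1)] K) • (Measure.dirac u + Measure.dirac u'))

/-- The moment of a Borel measure on the sphere corresponding to the
multi-index `i : Fin n → ℕ`. -/
def sphMoment {n : ℕ} (μ : Measure (Sph n)) (i : Fin n → ℕ) : ℝ :=
  ∫ u, ∏ j, ((u : En n) j) ^ (i j) ∂μ

theorem volume_add_volume_le_two_mul_of_isCompact {A B C : Set ℝ} (hA : IsCompact A)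
    (hB : IsCompact B) (hAne : A.Nonempty) (hBne : B.Nonempty)
    (h : ∀ a ∈ A, ∀ b ∈ B, (a + b) / 2 ∈ C) :
    volume A + volume B ≤ 2 * volume C := by
  obtain ⟨a, haA, ha⟩ := hA.exists_isGreatest hAne
  obtain ⟨b, hbB, hb⟩ := hB.exists_isLeast hBne
  have h2C : volume ((fun x : ℝ => 2⁻¹ * x) ⁻¹' C) = 2 * volume C := by
    rw [Real.volume_preimage_mul_left (by norm_num)]
    norm_num
  rw [← h2C]
  have e1 : volume A = volume ((fun x => x + (-b)) ⁻¹' A) := by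
    rw [measure_preimage_add_right]
  have e2 : volume B = volume (((fun x => x + (-a)) ⁻¹' B) \ {a + b}) := by
    rw [measure_sdiff_null (by simp), measure_preimage_add_right]
  rw [e1, e2, ← measure_union]
  · refine measure_mono ?_
    rintro x (hx | ⟨hx, -⟩)
    · have := h _ hx b hbB
      simp only [Set.mem_preimage]
      convert this using 1; ring
    · have := h a haA _ hx
      simp only [Set.mem_preimage]
      convert this using 1; ring
  · rw [Set.disjoint_left]
    rintro x hx ⟨hx1, hx2⟩
    apply hx2
    have h1 := ha hx
    have h2 := hb hx1
    simp only [Set.mem_singleton_iff]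
    linarith
  · refine MeasurableSet.diff ?_ (measurableSet_singleton _)
    exact (measurable_add_const _) hB.measurableSet

theorem volume_add_volume_le_two_mul {A B C : Set ℝ} (hA : MeasurableSet A)
    (hB : MeasurableSet B) (hAne : A.Nonempty) (hBne : B.Nonempty)
    (h : ∀ a ∈ A, ∀ b ∈ B, (a + b) / 2 ∈ C) :
    volume A + volume B ≤ 2 * volume C := by
  have key : ∀ A' ⊆ A, IsCompact A' → ∀ B' ⊆ B, IsCompact B' →
      volume A' + volume B' ≤ 2 * volume C := by
    intro A' hA' hA'c B' hB' hB'c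
    obtain ⟨a, ha⟩ := hAne
    obtain ⟨b, hb⟩ := hBne
    refine le_trans (add_le_add (measure_mono (Set.subset_insert a A'))
      (measure_mono (Set.subset_insert b B'))) ?_
    refine volume_add_volume_le_two_mul_of_isCompact (hA'c.insert a) (hB'c.insert b)
      (Set.insert_nonempty _ _) (Set.insert_nonempty _ _) ?_
    intro x hx y hy
    exact h x (Set.insert_subset ha hA' hx) y (Set.insert_subset hb hB' hy)
  have key2 : ∀ B' ⊆ B, IsCompact B' → volume A + volume B' ≤ 2 * volume C := by
    intro B' hB' hB'c
    have hle : volume B' ≤ 2 * volume C := by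
      simpa using key ∅ (Set.empty_subset _) isCompact_empty B' hB' hB'c
    refine add_le_of_le_tsub_right_of_le hle ?_
    rw [hA.measure_eq_iSup_isCompact]
    refine iSup_le fun A' => iSup_le fun hA' => iSup_le fun hA'c => ?_
    exact ENNReal.le_sub_of_add_le_right hB'c.measure_lt_top.ne (key A' hA' hA'c B' hB' hB'c)
  have hle : volume A ≤ 2 * volume C := by
    simpa using key2 ∅ (Set.empty_subset _) isCompact_empty
  by_cases hAt : volume A = ⊤
  · have : 2 * volume C = ⊤ := top_le_iff.1 (hAt ▸ hle)
    rw [this]; exact le_top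
  · rw [add_comm]
    refine add_le_of_le_tsub_right_of_le hle ?_
    rw [hB.measure_eq_iSup_isCompact]
    refine iSup_le fun B' => iSup_le fun hB' => iSup_le fun hB'c => ?_
    refine ENNReal.le_sub_of_add_le_right hAt ?_
    rw [add_comm]
    exact key2 B' hB' hB'c

theorem ENNReal.mul_le_sq_of_add_le_two_mul {x y z : ℝ≥0∞} (h : x + y ≤ 2 * z) :
    x * y ≤ z ^ 2 := by
  by_cases hz : z = ⊤
  · simp [hz]
  have h2z : 2 * z ≠ ⊤ := ENNReal.mul_ne_top (by simp) hz
  have hx : x ≠ ⊤ := fun hx => h2z (by simpa [hx] using h)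
  have hy : y ≠ ⊤ := fun hy => h2z (by simpa [hy] using h)
  lift x to ℝ≥0 using hx
  lift y to ℝ≥0 using hy
  lift z to ℝ≥0 using hz
  norm_cast at h ⊢
  rw [← NNReal.coe_le_coe] at h ⊢
  push_cast at h ⊢
  have hx := x.coe_nonneg
  have hy := y.coe_nonneg
  nlinarith [sq_nonneg ((x : ℝ) - y)]

theorem lintegral_eq_lintegral_Ioo_of_le_one {f : ℝ → ℝ≥0∞} (hf : Measurable f)
    (hf1 : ∀ x, f x ≤ 1) :
    ∫⁻ x, f x = ∫⁻ t in Set.Ioo (0 : ℝ) 1, volume {x | ENNReal.ofReal t < f x} := by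
  have h1 : ∀ x, f x ≠ ⊤ := fun x => ((hf1 x).trans_lt ENNReal.one_lt_top).ne
  have h2 : ∫⁻ x, f x = ∫⁻ x, ENNReal.ofReal (f x).toReal := by
    simp [ENNReal.ofReal_toReal (h1 _)]
  rw [h2, lintegral_eq_lintegral_meas_lt _ (Eventually.of_forall fun x => ENNReal.toReal_nonneg)
    hf.ennreal_toReal.aemeasurable]
  have h3 : Set.Ioi (0 : ℝ) = Set.Ioo 0 1 ∪ Set.Ici 1 := by
    ext t; simp only [Set.mem_Ioi, Set.mem_union, Set.mem_Ioo, Set.mem_Ici]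
    constructor
    · intro h; rcases lt_or_ge t 1 with h' | h'
      · exact Or.inl ⟨h, h'⟩
      · exact Or.inr h'
    · rintro (h | h) <;> linarith
  rw [h3, lintegral_union measurableSet_Ici]
  · have h4 : ∫⁻ t in Set.Ici (1 : ℝ), volume {x | t < (f x).toReal} = 0 := by
      rw [setLIntegral_congr_fun (g := fun _ => 0) measurableSet_Ici]
      · simp
      · intro t ht
        have : {x | t < (f x).toReal} = ∅ := by
          ext x
          simp only [Set.mem_ofPred_eq, Set.mem_empty_iff_false, iff_false, not_lt]
          refine le_trans ?_ ht
          exact ENNReal.toReal_le_of_le_ofReal zero_le_one (by simpa using hf1 x)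
        simp [this]
    rw [h4, add_zero]
    refine setLIntegral_congr_fun measurableSet_Ioo ?_
    intro t ht
    have : {x | t < (f x).toReal} = {x | ENNReal.ofReal t < f x} := by
      ext x
      exact (ENNReal.ofReal_lt_iff_lt_toReal ht.1.le (h1 x)).symm
    simp only [this]
  · rw [Set.disjoint_left]
    intro t ht ht'
    exact absurd ht.2 (not_lt.2 ht')

theorem prekopaLeindler_real_of_iSup_eq_one {f g h : ℝ → ℝ≥0∞} (hf : Measurable f)
    (hg : Measurable g) (hh : Measurable h) (hf1 : ⨆ x, f x = 1) (hg1 : ⨆ x, g x = 1)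
    (H : ∀ x y, f x * g y ≤ h ((x + y) / 2) ^ 2) :
    (∫⁻ x, f x) * ∫⁻ x, g x ≤ (∫⁻ x, h x) ^ 2 := by
  apply ENNReal.mul_le_sq_of_add_le_two_mul
  have hmin : ∫⁻ x, min (h x) 1 ≤ ∫⁻ x, h x := lintegral_mono fun x => min_le_left _ _
  refine le_trans ?_ (mul_le_mul_right hmin 2)
  rw [lintegral_eq_lintegral_Ioo_of_le_one hf (fun x => hf1 ▸ le_iSup f x),
    lintegral_eq_lintegral_Ioo_of_le_one hg (fun x => hg1 ▸ le_iSup g x),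
    lintegral_eq_lintegral_Ioo_of_le_one (hh.min measurable_const) (fun x => min_le_right _ _),
    ← lintegral_const_mul' _ _ (by simp)]
  refine le_trans (le_lintegral_add _ _) ?_
  refine setLIntegral_mono' measurableSet_Ioo ?_
  intro t ht
  have ht1 : ENNReal.ofReal t < 1 := by simpa using ht.2
  refine volume_add_volume_le_two_mul (measurableSet_lt measurable_const hf)
    (measurableSet_lt measurable_const hg) ?_ ?_ ?_
  · exact lt_iSup_iff.1 (hf1.symm ▸ ht1)
  · exact lt_iSup_iff.1 (hg1.symm ▸ ht1)
  · intro a ha b hb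
    refine lt_min ?_ ht1
    by_contra hcon
    push Not at hcon
    have h1 := H a b
    have h2 : ENNReal.ofReal t * ENNReal.ofReal t < f a * g b := ENNReal.mul_lt_mul ha hb
    have h3 : h ((a + b) / 2) ^ 2 ≤ ENNReal.ofReal t ^ 2 := by gcongr
    rw [← sq] at h2
    exact absurd (h2.trans_le (h1.trans h3)) (lt_irrefl _)

theorem prekopaLeindler_real_of_bounded {f g h : ℝ → ℝ≥0∞} (hf : Measurable f)
    (hg : Measurable g) (hh : Measurable h) (hf1 : ⨆ x, f x ≠ ⊤) (hg1 : ⨆ x, g x ≠ ⊤)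
    (H : ∀ x y, f x * g y ≤ h ((x + y) / 2) ^ 2) :
    (∫⁻ x, f x) * ∫⁻ x, g x ≤ (∫⁻ x, h x) ^ 2 := by
  set a := ⨆ x, f x with ha
  set b := ⨆ x, g x with hb
  rcases eq_or_ne a 0 with ha0 | ha0
  · have : ∀ x, f x = 0 := fun x => by
      have := le_iSup f x
      rw [← ha, ha0] at this
      simpa using this
    simp [this]
  rcases eq_or_ne b 0 with hb0 | hb0
  · have : ∀ x, g x = 0 := fun x => by
      have := le_iSup g x
      rw [← hb, hb0] at this
      simpa using this
    simp [this]
  have hc : ((a * b) ^ (1 / 2 : ℝ)) ^ 2 = a * b := by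
    rw [← ENNReal.rpow_natCast, ← ENNReal.rpow_mul]; norm_num
  set c := (a * b) ^ (1 / 2 : ℝ)
  have hab0 : a * b ≠ 0 := mul_ne_zero ha0 hb0
  have habt : a * b ≠ ⊤ := ENNReal.mul_ne_top hf1 hg1
  have hc0 : c ≠ 0 := by rintro h0; apply hab0; rw [← hc, h0]; simp
  have hct : c ≠ ⊤ := by rintro h0; apply habt; rw [← hc, h0]; simp
  have key := prekopaLeindler_real_of_iSup_eq_one (f := fun x => a⁻¹ * f x)
    (g := fun x => b⁻¹ * g x) (h := fun x => c⁻¹ * h x) (hf.const_mul _) (hg.const_mul _)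
    (hh.const_mul _)
    (by rw [← ENNReal.mul_iSup, ← ha, ENNReal.inv_mul_cancel ha0 hf1])
    (by rw [← ENNReal.mul_iSup, ← hb, ENNReal.inv_mul_cancel hb0 hg1]) ?_
  · rw [lintegral_const_mul _ hf, lintegral_const_mul _ hg, lintegral_const_mul _ hh, mul_pow,
      mul_mul_mul_comm, ← ENNReal.mul_inv (Or.inl ha0) (Or.inl hf1), ← ENNReal.inv_pow, hc] at key
    rwa [ENNReal.mul_le_mul_iff_right (by simpa using habt) (by simpa using hab0)] at key
  · intro x y
    rw [mul_mul_mul_comm, ← ENNReal.mul_inv (Or.inl ha0) (Or.inl hf1), mul_pow, ← ENNReal.inv_pow,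
      hc]
    exact mul_le_mul_right (H x y) _

theorem lintegral_eq_iSup_lintegral_min {f : ℝ → ℝ≥0∞} (hf : Measurable f) :
    ∫⁻ x, f x = ⨆ k : ℕ, ∫⁻ x, min (f x) k := by
  rw [← lintegral_iSup (fun k => hf.min measurable_const)]
  · congr 1; ext x
    rw [← inf_iSup_eq, ENNReal.iSup_natCast, inf_top_eq]
  · intro i j hij x
    simp only
    gcongr

theorem prekopaLeindler_real {f g h : ℝ → ℝ≥0∞} (hf : Measurable f)
    (hg : Measurable g) (hh : Measurable h)
    (H : ∀ x y, f x * g y ≤ h ((x + y) / 2) ^ 2) :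
    (∫⁻ x, f x) * ∫⁻ x, g x ≤ (∫⁻ x, h x) ^ 2 := by
  rw [lintegral_eq_iSup_lintegral_min hf, ENNReal.iSup_mul]
  refine iSup_le fun k => ?_
  rw [lintegral_eq_iSup_lintegral_min hg, ENNReal.mul_iSup]
  refine iSup_le fun l => ?_
  refine prekopaLeindler_real_of_bounded (hf.min measurable_const) (hg.min measurable_const) hh
    ?_ ?_ ?_
  · exact ((iSup_le fun x => min_le_right _ _).trans_lt (ENNReal.natCast_lt_top k)).ne
  · exact ((iSup_le fun x => min_le_right _ _).trans_lt (ENNReal.natCast_lt_top l)).ne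
  · intro x y
    exact (mul_le_mul' (min_le_left _ _) (min_le_left _ _)).trans (H x y)

theorem prekopaLeindler_pi (n : ℕ) {f g h : (Fin n → ℝ) → ℝ≥0∞} (hf : Measurable f)
    (hg : Measurable g) (hh : Measurable h)
    (H : ∀ x y, f x * g y ≤ h ((2⁻¹ : ℝ) • (x + y)) ^ 2) :
    (∫⁻ x, f x) * ∫⁻ x, g x ≤ (∫⁻ x, h x) ^ 2 := by
  induction n with
  | zero =>
    have h0 : ∀ F : (Fin 0 → ℝ) → ℝ≥0∞, ∫⁻ x, F x = F 0 := by
      intro F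
      rw [Measure.volume_pi_eq_dirac 0, lintegral_dirac]
    simpa [h0] using H 0 0
  | succ n ih =>
    have e := (volume_preserving_piFinSuccAbove (fun _ : Fin (n + 1) => ℝ) 0).symm
    have hE : ∀ F : (Fin (n + 1) → ℝ) → ℝ≥0∞, Measurable F →
        ∫⁻ x, F x = ∫⁻ s : ℝ, ∫⁻ w : Fin n → ℝ, F (Fin.cons s w) := by
      intro F hF
      rw [← e.lintegral_comp hF, Measure.volume_eq_prod, lintegral_prod _ (by fun_prop)]
      simp [MeasurableEquiv.piFinSuccAbove, Fin.consEquiv]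
    have hm : ∀ F : (Fin (n + 1) → ℝ) → ℝ≥0∞, Measurable F →
        Measurable fun p : ℝ × (Fin n → ℝ) => F (Fin.cons p.1 p.2) := by
      intro F hF
      have h1 := hF.comp e.measurable
      have h2 : (F ∘ (MeasurableEquiv.piFinSuccAbove (fun _ : Fin (n + 1) => ℝ) 0).symm) =
          fun p : ℝ × (Fin n → ℝ) => F (Fin.cons p.1 p.2) := by
        ext p
        simp [MeasurableEquiv.piFinSuccAbove, Fin.consEquiv]
      rwa [h2] at h1
    rw [hE f hf, hE g hg, hE h hh]
    refine prekopaLeindler_real (hm f hf).lintegral_prod_right'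
      (hm g hg).lintegral_prod_right' (hm h hh).lintegral_prod_right' ?_
    intro s t
    refine ih ((hm f hf).comp measurable_prodMk_left) ((hm g hg).comp measurable_prodMk_left)
      ((hm h hh).comp measurable_prodMk_left) ?_
    intro x y
    refine (H _ _).trans (le_of_eq ?_)
    congr 2
    ext i
    refine Fin.cases ?_ (fun j => ?_) i
    · simp; ring
    · simp; ring

/-- The Prékopa–Leindler inequality for midpoints. -/
theorem prekopaLeindler {n : ℕ} {f g h : En n → ℝ≥0∞} (hf : Measurable f)
    (hg : Measurable g) (hh : Measurable h)
    (H : ∀ x y, f x * g y ≤ h ((2⁻¹ : ℝ) • (x + y)) ^ 2) :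
    (∫⁻ x, f x) * ∫⁻ x, g x ≤ (∫⁻ x, h x) ^ 2 := by
  have e := PiLp.volume_preserving_toLp (Fin n)
  rw [← e.lintegral_comp hf, ← e.lintegral_comp hg, ← e.lintegral_comp hh]
  refine prekopaLeindler_pi n (hf.comp e.measurable) (hg.comp e.measurable)
    (hh.comp e.measurable) ?_
  intro x y
  exact H _ _

theorem nonpos_of_forall_le_mul {x C δ : ℝ} (hδ : 0 < δ)
    (h : ∀ ε, 0 < ε → ε ≤ δ → x ≤ ε * C) : x ≤ 0 := by
  by_contra hx
  push Not at hx
  have hC : 0 < C := by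
    by_contra hC
    push Not at hC
    have := h δ hδ le_rfl
    nlinarith
  have h1 := h (min δ (x / (2 * C))) (lt_min hδ (by positivity)) (min_le_left _ _)
  have h2 : min δ (x / (2 * C)) * C ≤ x / (2 * C) * C := by
    gcongr; exact min_le_right _ _
  have h3 : x / (2 * C) * C = x / 2 := by field_simp
  linarith

theorem mul_sub_le_of_perturbed_mul_le_sq {v a b m c ε : ℝ} (ha : 0 ≤ a) (hb : 0 ≤ b)
    (hm : 0 ≤ m) (hc : 0 ≤ c) (hε : 0 < ε) (hε1 : ε ≤ 1)
    (h : (v + ε ^ 2 * a - ε ^ 3 * c) * (v + ε ^ 2 * b - ε ^ 3 * c) ≤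
      (v + ε ^ 2 * m + ε ^ 3 * c) ^ 2) :
    v * (a + b - 2 * m) ≤ ε * (4 * v * c + (m + c) ^ 2 + (a + c) * (b + c)) := by
  have k4 : ε ^ 2 * (v * (a + b - 2 * m)) ≤
      ε ^ 2 * (4 * v * c * ε + ε ^ 2 * ((m + ε * c) ^ 2 - (a - ε * c) * (b - ε * c))) := by
    linear_combination h
  refine (le_of_mul_le_mul_left k4 (by positivity)).trans ?_
  have t1 : ε * (c * (a + b)) ≤ 1 * (c * (a + b)) := by gcongr
  have t0 : ε * c ≤ c := mul_le_of_le_one_left hc hε1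
  have k6 : (m + ε * c) ^ 2 ≤ (m + c) ^ 2 := by gcongr
  have k7 : -((a - ε * c) * (b - ε * c)) ≤ (a + c) * (b + c) := by
    have t2 := mul_nonneg ha hb
    have t3 := sq_nonneg (ε * c)
    have t4 := sq_nonneg c
    linarith
  have t5 : ε ^ 2 ≤ ε := by rw [sq]; exact mul_le_of_le_one_left hε.le hε1
  have hnn : 0 ≤ (m + c) ^ 2 + (a + c) * (b + c) := by positivity
  have k8 : ε ^ 2 * ((m + ε * c) ^ 2 - (a - ε * c) * (b - ε * c)) ≤
      ε * ((m + c) ^ 2 + (a + c) * (b + c)) :=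
    calc ε ^ 2 * ((m + ε * c) ^ 2 - (a - ε * c) * (b - ε * c))
        ≤ ε ^ 2 * ((m + c) ^ 2 + (a + c) * (b + c)) := by gcongr; linarith
      _ ≤ _ := by gcongr
  linarith

section Equality

variable {n : ℕ} {A B M : Set (En n)}

theorem setIntegral_mul_le_sq (hA : IsCompact A) (hB : IsCompact B) (hM : IsCompact M)
    (hmid : ∀ x ∈ A, ∀ y ∈ B, (2⁻¹ : ℝ) • (x + y) ∈ M) {p q r : En n → ℝ}
    (hp : Continuous p) (hq : Continuous q) (hr : Continuous r)
    (hp0 : ∀ x ∈ A, 0 ≤ p x) (hq0 : ∀ x ∈ B, 0 ≤ q x) (hr0 : ∀ x ∈ M, 0 ≤ r x)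
    (H : ∀ x ∈ A, ∀ y ∈ B, p x * q y ≤ r ((2⁻¹ : ℝ) • (x + y)) ^ 2) :
    (∫ x in A, p x) * ∫ x in B, q x ≤ (∫ x in M, r x) ^ 2 := by
  have conv : ∀ {S : Set (En n)} {f : En n → ℝ}, IsCompact S → Continuous f →
      (∀ x ∈ S, 0 ≤ f x) →
      ∫⁻ x, S.indicator (fun x => ENNReal.ofReal (f x)) x = ENNReal.ofReal (∫ x in S, f x) := by
    intro S f hS hf hf0
    rw [lintegral_indicator hS.measurableSet,
      ofReal_integral_eq_lintegral_ofReal (hf.continuousOn.integrableOn_compact hS)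
        (ae_restrict_of_forall_mem hS.measurableSet hf0)]
  have meas : ∀ {S : Set (En n)} {f : En n → ℝ}, IsCompact S → Continuous f →
      Measurable (S.indicator (fun x => ENNReal.ofReal (f x))) := fun hS hf =>
    (hf.measurable.ennreal_ofReal).indicator hS.measurableSet
  have key := prekopaLeindler (meas hA hp) (meas hB hq) (meas hM hr) (by
    intro x y
    by_cases hx : x ∈ A
    · by_cases hy : y ∈ B
      · rw [Set.indicator_of_mem hx, Set.indicator_of_mem hy, Set.indicator_of_mem (hmid x hx y hy),
          ← ENNReal.ofReal_mul (hp0 x hx), ← ENNReal.ofReal_pow (hr0 _ (hmid x hx y hy))]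
        exact ENNReal.ofReal_le_ofReal (H x hx y hy)
      · simp [Set.indicator_of_notMem hy]
    · simp [Set.indicator_of_notMem hx])
  have nn : ∀ {S : Set (En n)} {f : En n → ℝ}, IsCompact S →
      (∀ x ∈ S, 0 ≤ f x) → 0 ≤ ∫ x in S, f x := fun hS hf =>
    setIntegral_nonneg hS.measurableSet hf
  rw [conv hA hp hp0, conv hB hq hq0, conv hM hr hr0, ← ENNReal.ofReal_mul (nn hA hp0),
    ← ENNReal.ofReal_pow (nn hM hr0)] at key
  exact (ENNReal.ofReal_le_ofReal_iff (sq_nonneg _)).1 key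

theorem volume_mul_volume_le_sq (hA : IsCompact A) (hB : IsCompact B) (hM : IsCompact M)
    (hmid : ∀ x ∈ A, ∀ y ∈ B, (2⁻¹ : ℝ) • (x + y) ∈ M) :
    volume.real A * volume.real B ≤ volume.real M ^ 2 := by
  simpa using setIntegral_mul_le_sq hA hB hM hmid (p := fun _ => 1) (q := fun _ => 1)
    (r := fun _ => 1) continuous_const continuous_const continuous_const (by simp) (by simp)
    (by simp) (by simp)

theorem IsCompact.exists_pos_forall_abs_le {S : Set (En n)} {f : En n → ℝ} (hS : IsCompact S)
    (hf : Continuous f) : ∃ C, 0 < C ∧ ∀ x ∈ S, |f x| ≤ C := by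
  obtain ⟨C, hC⟩ := hS.exists_bound_of_continuousOn hf.continuousOn
  exact ⟨max C 1, by positivity, fun x hx => (hC x hx).trans (le_max_left _ _)⟩

theorem setIntegral_add_le_two_mul (hA : IsCompact A) (hB : IsCompact B) (hM : IsCompact M)
    (hmid : ∀ x ∈ A, ∀ y ∈ B, (2⁻¹ : ℝ) • (x + y) ∈ M) {v : ℝ} (hv : 0 < v)
    (hAv : volume.real A = v) (hBv : volume.real B = v) (hMv : volume.real M = v)
    {p q r : En n → ℝ}
    (hp : Continuous p) (hq : Continuous q) (hr : Continuous r)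
    (H : ∀ x ∈ A, ∀ y ∈ B, p x + q y ≤ 2 * r ((2⁻¹ : ℝ) • (x + y))) :
    (∫ x in A, p x) + ∫ x in B, q x ≤ 2 * ∫ x in M, r x := by
  obtain ⟨C₁, hC₁, hpC⟩ := hA.exists_pos_forall_abs_le hp
  obtain ⟨C₂, hC₂, hqC⟩ := hB.exists_pos_forall_abs_le hq
  obtain ⟨C₃, hC₃, hrC⟩ := hM.exists_pos_forall_abs_le hr
  have expand : ∀ {S : Set (En n)} {f : En n → ℝ}, IsCompact S → Continuous f → ∀ ε : ℝ,
      ∫ x in S, (1 + ε * f x) = volume.real S + ε * ∫ x in S, f x := by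
    intro S f hS hf ε
    rw [integral_add, integral_const_mul]
    · simp
    · exact (continuous_const (y := (1 : ℝ))).continuousOn.integrableOn_compact hS
    · exact (hf.const_mul ε).continuousOn.integrableOn_compact hS
  have nn : ∀ {ε c C : ℝ}, 0 < ε → ε ≤ 1 / (C₁ + C₂ + C₃) → C ≤ C₁ + C₂ + C₃ → |c| ≤ C →
      0 ≤ 1 + ε * c := by
    intro ε c C hε hε1 hC hc
    have h1 : -(C₁ + C₂ + C₃) ≤ c := by linarith [neg_abs_le c]
    have h2 : ε * (C₁ + C₂ + C₃) ≤ 1 := by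
      rwa [le_div_iff₀ (by positivity)] at hε1
    nlinarith
  have h0 : v * ((∫ x in A, p x) + (∫ x in B, q x) - 2 * ∫ x in M, r x) ≤ 0 := by
    refine nonpos_of_forall_le_mul (δ := 1 / (C₁ + C₂ + C₃))
      (C := (∫ x in M, r x) ^ 2 - (∫ x in A, p x) * ∫ x in B, q x) (by positivity) ?_
    intro ε hε hε1
    have key := setIntegral_mul_le_sq hA hB hM hmid
      (p := fun x => 1 + ε * p x) (q := fun x => 1 + ε * q x) (r := fun x => 1 + ε * r x)
      (by fun_prop) (by fun_prop) (by fun_prop)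
      (fun x hx => nn hε hε1 (by linarith) (hpC x hx))
      (fun x hx => nn hε hε1 (by linarith) (hqC x hx))
      (fun x hx => nn hε hε1 (by linarith) (hrC x hx))
      (by
        intro x hx y hy
        have h1 := nn hε hε1 (by linarith) (hpC x hx)
        have h2 := nn hε hε1 (by linarith) (hqC y hy)
        have h3 := mul_le_mul_of_nonneg_left (H x hx y hy) hε.le
        set R := r ((2⁻¹ : ℝ) • (x + y))
        have h4 : 1 + ε * ((p x + q y) / 2) ≤ 1 + ε * R := by linarith
        have h5 : (1 + ε * ((p x + q y) / 2)) ^ 2 ≤ (1 + ε * R) ^ 2 := by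
          have : 0 ≤ 1 + ε * ((p x + q y) / 2) := by linarith
          gcongr
        nlinarith [sq_nonneg (ε * (p x - q y))])
    rw [expand hA hp, expand hB hq, expand hM hr, hAv, hBv, hMv] at key
    have : ε * (v * ((∫ x in A, p x) + (∫ x in B, q x) - 2 * ∫ x in M, r x)) ≤
        ε * (ε * ((∫ x in M, r x) ^ 2 - (∫ x in A, p x) * ∫ x in B, q x)) := by
      linarith
    exact le_of_mul_le_mul_left this hε
  by_contra hcon
  push Not at hcon
  nlinarith

theorem abs_exp_sub_quadratic_le {t : ℝ} (ht : |t| ≤ 1) :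
    |exp t - (1 + t + t ^ 2 / 2)| ≤ |t| ^ 3 := by
  have h := Real.exp_bound ht (n := 3) (by norm_num)
  have e : ∑ m ∈ Finset.range 3, t ^ m / (m.factorial : ℝ) = 1 + t + t ^ 2 / 2 := by
    simp [Finset.sum_range_succ, Nat.factorial]
  rw [e] at h
  refine h.trans ?_
  have : (0 : ℝ) ≤ |t| ^ 3 := by positivity
  norm_num [Nat.factorial]
  linarith

theorem abs_setIntegral_exp_sub_le {S : Set (En n)} (hS : IsCompact S) {s : En n → ℝ}
    (hs : Continuous s) {C : ℝ} (hsC : ∀ x ∈ S, |s x| ≤ C) {ε : ℝ} (hε : 0 < ε)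
    (hεC : ε * C ≤ 1) (hs0 : ∫ x in S, s x = 0) :
    |(∫ x in S, exp (ε * s x)) - (volume.real S + ε ^ 2 * ((∫ x in S, s x ^ 2) / 2))| ≤
      ε ^ 3 * (C ^ 3 * volume.real S) := by
  have hI : ∀ {f : En n → ℝ}, Continuous f → IntegrableOn f S := fun hf =>
    hf.continuousOn.integrableOn_compact hS
  have e1 : (∫ x in S, exp (ε * s x)) - (volume.real S + ε ^ 2 * ((∫ x in S, s x ^ 2) / 2)) =
      ∫ x in S, (exp (ε * s x) - (1 + ε * s x + ε ^ 2 / 2 * s x ^ 2)) := by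
    rw [integral_sub (hI (by fun_prop)) (hI (by fun_prop)),
      integral_add (hI (by fun_prop)) (hI (by fun_prop)),
      integral_add (hI (by fun_prop)) (hI (by fun_prop)), integral_const_mul, integral_const_mul,
      hs0]
    simp
    ring
  rw [e1, ← Real.norm_eq_abs]
  have := norm_setIntegral_le_of_norm_le_const (μ := volume) (s := S)
    (f := fun x => exp (ε * s x) - (1 + ε * s x + ε ^ 2 / 2 * s x ^ 2)) (C := ε ^ 3 * C ^ 3)
    hS.measure_lt_top (fun x hx => by
      have h1 : |ε * s x| ≤ ε * C := by
        rw [abs_mul, abs_of_pos hε]; gcongr; exact hsC x hx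
      have h2 := abs_exp_sub_quadratic_le (h1.trans hεC)
      have h3 : |ε * s x| ^ 3 ≤ (ε * C) ^ 3 := by gcongr
      rw [Real.norm_eq_abs, ← mul_pow]
      refine le_trans (le_of_eq ?_) (h2.trans h3)
      congr 1; ring)
  linarith

theorem setIntegral_sq_add_le_two_mul (hA : IsCompact A) (hB : IsCompact B) (hM : IsCompact M)
    (hmid : ∀ x ∈ A, ∀ y ∈ B, (2⁻¹ : ℝ) • (x + y) ∈ M) {v : ℝ} (hv : 0 < v)
    (hAv : volume.real A = v) (hBv : volume.real B = v) (hMv : volume.real M = v)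
    (s : En n →L[ℝ] ℝ) (hA0 : ∫ x in A, s x = 0) (hB0 : ∫ x in B, s x = 0) :
    (∫ x in A, s x ^ 2) + ∫ x in B, s x ^ 2 ≤ 2 * ∫ x in M, s x ^ 2 := by
  have hs := s.continuous
  have hM0 : ∫ x in M, s x = 0 := by
    have h1 := setIntegral_add_le_two_mul hA hB hM hmid hv hAv hBv hMv hs hs hs
      (by intro x _ y _; simp; linarith)
    have h2 := setIntegral_add_le_two_mul hA hB hM hmid hv hAv hBv hMv
      (p := fun x => -s x) (q := fun x => -s x) (r := fun x => -s x) hs.neg hs.neg hs.neg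
      (by intro x _ y _; simp; linarith)
    rw [integral_neg, integral_neg, integral_neg] at h2
    linarith
  obtain ⟨C₁, hC₁, hA1⟩ := hA.exists_pos_forall_abs_le hs
  obtain ⟨C₂, hC₂, hB1⟩ := hB.exists_pos_forall_abs_le hs
  obtain ⟨C₃, hC₃, hM1⟩ := hM.exists_pos_forall_abs_le hs
  set C := C₁ + C₂ + C₃ + 1 with hC
  have hCpos : 0 < C := by positivity
  set a := (∫ x in A, s x ^ 2) / 2 with ha
  set b := (∫ x in B, s x ^ 2) / 2 with hb
  set m := (∫ x in M, s x ^ 2) / 2 with hm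
  have ha0 : 0 ≤ a := div_nonneg (integral_nonneg fun x => sq_nonneg _) zero_le_two
  have hb0 : 0 ≤ b := div_nonneg (integral_nonneg fun x => sq_nonneg _) zero_le_two
  have hm0 : 0 ≤ m := div_nonneg (integral_nonneg fun x => sq_nonneg _) zero_le_two
  set c := C ^ 3 * v with hc
  have hc0 : 0 < c := by positivity
  have h0 : v * (a + b - 2 * m) ≤ 0 := by
    refine nonpos_of_forall_le_mul (δ := 1 / C)
      (C := 4 * v * c + (m + c) ^ 2 + (a + c) * (b + c)) (by positivity) ?_
    intro ε hε hε1
    have hεC : ε * C ≤ 1 := by rwa [le_div_iff₀ hCpos] at hε1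
    have hεle : ε ≤ 1 := by nlinarith
    have kA := abs_setIntegral_exp_sub_le hA hs (C := C)
      (fun x hx => (hA1 x hx).trans (by linarith)) hε hεC hA0
    have kB := abs_setIntegral_exp_sub_le hB hs (C := C)
      (fun x hx => (hB1 x hx).trans (by linarith)) hε hεC hB0
    have kM := abs_setIntegral_exp_sub_le hM hs (C := C)
      (fun x hx => (hM1 x hx).trans (by linarith)) hε hεC hM0
    rw [hAv, ← ha, ← hc] at kA
    rw [hBv, ← hb, ← hc] at kB
    rw [hMv, ← hm, ← hc] at kM
    have key := setIntegral_mul_le_sq hA hB hM hmid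
      (p := fun x => exp (ε * s x)) (q := fun x => exp (ε * s x)) (r := fun x => exp (ε * s x))
      (by fun_prop) (by fun_prop) (by fun_prop)
      (fun x _ => (exp_pos _).le) (fun x _ => (exp_pos _).le) (fun x _ => (exp_pos _).le)
      (by
        intro x _ y _
        rw [← exp_add, ← exp_nat_mul]
        refine le_of_eq (congrArg exp ?_)
        simp; ring)
    have hεc : ε ^ 3 * c ≤ v := by
      have : (ε * C) ^ 3 ≤ 1 := pow_le_one₀ (by positivity) hεC
      calc ε ^ 3 * c = (ε * C) ^ 3 * v := by rw [hc]; ring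
        _ ≤ 1 * v := by gcongr
        _ = v := one_mul v
    have lA := (abs_le.1 kA).1
    have lB := (abs_le.1 kB).1
    have lM := (abs_le.1 kM).2
    set IA := ∫ x in A, exp (ε * s x)
    set IB := ∫ x in B, exp (ε * s x)
    set IM := ∫ x in M, exp (ε * s x) with hIM
    have hIM0 : 0 ≤ IM := integral_nonneg fun x => (exp_pos _).le
    have hε2 : 0 < ε ^ 2 := by positivity
    have nA : 0 ≤ v + ε ^ 2 * a - ε ^ 3 * c := by
      have := mul_nonneg hε2.le ha0
      linarith
    have nB : 0 ≤ v + ε ^ 2 * b - ε ^ 3 * c := by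
      have := mul_nonneg hε2.le hb0
      linarith
    have k1 : (v + ε ^ 2 * a - ε ^ 3 * c) * (v + ε ^ 2 * b - ε ^ 3 * c) ≤ IA * IB :=
      mul_le_mul (by linarith) (by linarith) nB (by linarith)
    have k2 : IM ^ 2 ≤ (v + ε ^ 2 * m + ε ^ 3 * c) ^ 2 := by
      gcongr; linarith
    have k3 := k1.trans (key.trans k2)
    exact mul_sub_le_of_perturbed_mul_le_sq ha0 hb0 hm0 hc0.le hε hεle k3
  have : a + b - 2 * m ≤ 0 := by
    by_contra hcon; push Not at hcon; nlinarith
  linarith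

theorem subset_of_setIntegral_infDist_nonpos (hA : IsCompact A) (hAcl : A ⊆ closure (interior A))
    (hB : IsClosed B) (hBne : B.Nonempty) (h : ∫ x in A, infDist x B ≤ 0) : A ⊆ B := by
  intro x hx
  by_contra hxB
  have hopen : IsOpen (Bᶜ ∩ interior A) := hB.isOpen_compl.inter isOpen_interior
  have hne : (Bᶜ ∩ interior A).Nonempty :=
    mem_closure_iff.1 (hAcl hx) Bᶜ hB.isOpen_compl hxB
  have hpos := hopen.measure_pos volume hne
  have hc : Continuous fun x => infDist x B := continuous_infDist_pt B
  have : 0 < ∫ x in A, infDist x B := by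
    rw [setIntegral_pos_iff_support_of_nonneg_ae (Eventually.of_forall fun x => infDist_nonneg)
      (hc.continuousOn.integrableOn_compact hA)]
    refine hpos.trans_le (measure_mono ?_)
    rintro y ⟨hy1, hy2⟩
    refine ⟨?_, interior_subset hy2⟩
    rw [Function.mem_support]
    intro h0
    exact hy1 ((hB.mem_iff_infDist_zero hBne).2 h0)
  linarith

theorem setIntegral_le_of_lipschitz (hA : IsCompact A) (hB : IsCompact B) (hM : IsCompact M)
    (hmid : ∀ x ∈ A, ∀ y ∈ B, (2⁻¹ : ℝ) • (x + y) ∈ M) {v : ℝ} (hv : 0 < v)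
    (hAv : volume.real A = v) (hBv : volume.real B = v) (hMv : volume.real M = v)
    (hA0 : ∀ s : En n →L[ℝ] ℝ, ∫ x in A, s x = 0) (hB0 : ∀ s : En n →L[ℝ] ℝ, ∫ x in B, s x = 0)
    {η : En n → ℝ} (hη : LipschitzWith 1 η) :
    ∫ x in A, η x ≤ ∫ x in B, η x := by
  have hI : ∀ {S : Set (En n)} {f : En n → ℝ}, IsCompact S → Continuous f → IntegrableOn f S :=
    fun hS hf => hf.continuousOn.integrableOn_compact hS
  have hsq : ∀ {S : Set (En n)}, IsCompact S → ∫ x in S, ‖x‖ ^ 2 =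
      ∑ i, ∫ x in S, (EuclideanSpace.proj i : En n →L[ℝ] ℝ) x ^ 2 := by
    intro S hS
    rw [← integral_finsetSum]
    · simp [EuclideanSpace.norm_sq_eq]
    · intro i _
      exact hI hS (by fun_prop)
  have hvar : (∫ x in A, ‖x‖ ^ 2) + ∫ x in B, ‖x‖ ^ 2 ≤ 2 * ∫ x in M, ‖x‖ ^ 2 := by
    rw [hsq hA, hsq hB, hsq hM, ← Finset.sum_add_distrib, Finset.mul_sum]
    exact Finset.sum_le_sum fun i _ =>
      setIntegral_sq_add_le_two_mul hA hB hM hmid hv hAv hBv hMv _ (hA0 _) (hB0 _)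
  have hηc := hη.continuous
  suffices (∫ x in A, η x) - ∫ x in B, η x ≤ 0 by linarith
  refine nonpos_of_forall_le_mul (δ := 1) (C := v / 2) one_pos ?_
  intro ε hε _
  have key := setIntegral_add_le_two_mul hA hB hM hmid hv hAv hBv hMv
    (p := fun x => -‖x‖ ^ 2 + ε * η x) (q := fun x => -‖x‖ ^ 2 + (-ε) * η x)
    (r := fun x => -‖x‖ ^ 2 + ε ^ 2 / 4) (by fun_prop) (by fun_prop) (by fun_prop) (by
      intro x _ y _
      have h1 : η x - η y ≤ ‖x - y‖ := by
        have := hη.dist_le_mul x y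
        rw [Real.dist_eq, dist_eq_norm] at this
        simp only [NNReal.coe_one, one_mul] at this
        exact (le_abs_self _).trans this
      have h2 := parallelogram_law_with_norm ℝ x y
      have h3 : ‖(2⁻¹ : ℝ) • (x + y)‖ = ‖x + y‖ / 2 := by
        rw [norm_smul]; norm_num; ring
      rw [h3]
      have h4 := mul_le_mul_of_nonneg_left h1 hε.le
      nlinarith [sq_nonneg (‖x - y‖ - ε)])
  rw [integral_add (hI hA (by fun_prop)) (hI hA (by fun_prop)),
    integral_add (hI hB (by fun_prop)) (hI hB (by fun_prop)),
    integral_add (hI hM (by fun_prop)) (hI hM (by fun_prop)),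
    integral_neg, integral_neg, integral_neg, integral_const_mul, integral_const_mul,
    setIntegral_const, hMv, smul_eq_mul] at key
  have : ε * ((∫ x in A, η x) - ∫ x in B, η x) ≤ ε * (ε * (v / 2)) := by linarith
  exact le_of_mul_le_mul_left this hε

theorem eq_of_volume_midpoint_of_centered (hA : IsCompact A) (hB : IsCompact B) (hM : IsCompact M)
    (hAcl : A ⊆ closure (interior A)) (hBcl : B ⊆ closure (interior B))
    (hmid : ∀ x ∈ A, ∀ y ∈ B, (2⁻¹ : ℝ) • (x + y) ∈ M) {v : ℝ} (hv : 0 < v)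
    (hAv : volume.real A = v) (hBv : volume.real B = v) (hMv : volume.real M = v)
    (hA0 : ∀ s : En n →L[ℝ] ℝ, ∫ x in A, s x = 0)
    (hB0 : ∀ s : En n →L[ℝ] ℝ, ∫ x in B, s x = 0) : A = B := by
  have ne : ∀ {S : Set (En n)}, volume.real S = v → S.Nonempty := by
    intro S hS
    by_contra hcon
    rw [Set.not_nonempty_iff_eq_empty] at hcon
    simp [hcon] at hS
    linarith
  have zero : ∀ {S : Set (En n)}, IsCompact S → ∫ x in S, infDist x S = 0 := by
    intro S hS
    rw [setIntegral_congr_fun (g := fun _ => (0 : ℝ)) hS.measurableSet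
      (fun x hx => infDist_zero_of_mem hx)]
    simp
  apply Set.Subset.antisymm
  · refine subset_of_setIntegral_infDist_nonpos hA hAcl hB.isClosed (ne hBv) ?_
    rw [← zero hB]
    exact setIntegral_le_of_lipschitz hA hB hM hmid hv hAv hBv hMv hA0 hB0 (lipschitz_infDist_pt B)
  · refine subset_of_setIntegral_infDist_nonpos hB hBcl hA.isClosed (ne hAv) ?_
    rw [← zero hA]
    refine setIntegral_le_of_lipschitz hB hA hM ?_ hv hBv hAv hMv hB0 hA0 (lipschitz_infDist_pt A)
    intro x hx y hy
    rw [add_comm]; exact hmid y hy x hx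

/-- Equality case of the Brunn–Minkowski inequality for midpoints of bodies of equal volume. -/
theorem exists_eq_image_add_of_volume_midpoint (hA : IsCompact A) (hB : IsCompact B)
    (hM : IsCompact M)
    (hAcl : A ⊆ closure (interior A)) (hBcl : B ⊆ closure (interior B))
    (hmid : ∀ x ∈ A, ∀ y ∈ B, (2⁻¹ : ℝ) • (x + y) ∈ M) {v : ℝ} (hv : 0 < v)
    (hAv : volume.real A = v) (hBv : volume.real B = v) (hMv : volume.real M = v) :
    ∃ x : En n, A = (fun y => y + x) '' B := by
  have hpre : ∀ (a : En n) (S : Set (En n)), (Homeomorph.addRight a) ⁻¹' S = (· + a) ⁻¹' S :=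
    fun _ _ => rfl
  have hcpt : ∀ (a : En n) {S : Set (En n)}, IsCompact S → IsCompact ((· + a) ⁻¹' S) :=
    fun a S hS => (Homeomorph.addRight a).isCompact_preimage.2 hS
  have hvol : ∀ (a : En n) (S : Set (En n)), volume.real ((· + a) ⁻¹' S) = volume.real S := by
    intro a S
    simp [Measure.real, measure_preimage_add_right]
  have hcl : ∀ (a : En n) {S : Set (En n)}, S ⊆ closure (interior S) →
      (· + a) ⁻¹' S ⊆ closure (interior ((· + a) ⁻¹' S)) := by
    intro a S hS
    rw [← hpre, ← Homeomorph.preimage_interior, ← Homeomorph.preimage_closure]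
    exact Set.preimage_mono hS
  have hcent : ∀ {S : Set (En n)}, IsCompact S → volume.real S = v → ∀ s : En n →L[ℝ] ℝ,
      ∫ x in (· + (v⁻¹ • ∫ x in S, x)) ⁻¹' S, s x = 0 := by
    intro S hS hSv s
    set a := v⁻¹ • ∫ x in S, x with ha
    have h1 := (measurePreserving_add_right (volume : Measure (En n)) a).setIntegral_preimage_emb
      (MeasurableEquiv.addRight a).measurableEmbedding (fun x => s (x - a)) S
    simp only [add_sub_cancel_right] at h1
    rw [h1]
    have hint : IntegrableOn (fun x : En n => x) S := continuousOn_id.integrableOn_compact hS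
    simp only [map_sub]
    rw [integral_sub (s.continuous.continuousOn.integrableOn_compact hS)
      ((continuous_const).continuousOn.integrableOn_compact hS), setIntegral_const, hSv,
      s.integral_comp_comm hint, ha, map_smul, smul_smul, mul_inv_cancel₀ hv.ne', one_smul, sub_self]
  set a := v⁻¹ • ∫ x in A, x
  set b := v⁻¹ • ∫ x in B, x
  have key := eq_of_volume_midpoint_of_centered (hcpt a hA) (hcpt b hB)
    (hcpt ((2⁻¹ : ℝ) • (a + b)) hM) (hcl a hAcl) (hcl b hBcl) (by
      intro x hx y hy
      have := hmid _ hx _ hy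
      simp only [Set.mem_preimage]
      convert this using 1
      rw [← smul_add]
      congr 1
      exact add_add_add_comm x y a b) hv (by rw [hvol, hAv]) (by rw [hvol, hBv]) (by rw [hvol, hMv])
      (hcent hA hAv) (hcent hB hBv)
  refine ⟨a - b, ?_⟩
  ext x
  have hx := Set.ext_iff.1 key (x - a)
  simp only [Set.mem_preimage, sub_add_cancel] at hx
  rw [hx]
  constructor
  · intro h
    exact ⟨x - a + b, h, by module⟩
  · rintro ⟨y, hy, rfl⟩
    convert hy using 1
    module

end Equality

theorem exists_hyperplane_chart {k : ℕ} {u : En (k + 1)} (hu : ‖u‖ = 1) :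
    ∃ ι : En k →ₗᵢ[ℝ] En (k + 1), (∀ w, ⟪ι w, u⟫_ℝ = 0) ∧
      (∀ x, ∃ w, x = ⟪x, u⟫_ℝ • u + ι w) ∧
      MeasurePreserving (fun p : ℝ × En k => p.1 • u + ι p.2) := by
  have hu0 : u ≠ 0 := by
    rintro rfl
    simp at hu
  have hfr : Module.finrank ℝ (ℝ ∙ u)ᗮ = k := by
    have : Fact (Module.finrank ℝ (En (k + 1)) = k + 1) := ⟨by simp⟩
    exact Submodule.finrank_orthogonal_span_singleton hu0
  let b : En k ≃ₗᵢ[ℝ] (ℝ ∙ u)ᗮ :=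
    ((stdOrthonormalBasis ℝ (ℝ ∙ u)ᗮ).reindex (finCongr hfr)).repr.symm
  let ι : En k →ₗᵢ[ℝ] En (k + 1) := (ℝ ∙ u)ᗮ.subtypeₗᵢ.comp b.toLinearIsometry
  have hι : ∀ w, ι w = (b w : En (k + 1)) := fun w => rfl
  have horth : ∀ w, ⟪ι w, u⟫_ℝ = 0 := by
    intro w
    rw [hι, real_inner_comm]
    exact Submodule.mem_orthogonal_singleton_iff_inner_right.1 (b w).2
  refine ⟨ι, horth, ?_, ?_⟩
  · intro x
    have hx : x - ⟪x, u⟫_ℝ • u ∈ (ℝ ∙ u)ᗮ := by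
      rw [Submodule.mem_orthogonal_singleton_iff_inner_left, inner_sub_left, inner_smul_left,
        real_inner_self_eq_norm_sq, hu]
      simp
    refine ⟨b.symm ⟨_, hx⟩, ?_⟩
    rw [hι, LinearIsometryEquiv.apply_symm_apply]
    simp
  · let e := LinearIsometryEquiv.toSpanUnitSingleton (𝕜 := ℝ) u hu
    let o := (ℝ ∙ u).orthogonalDecomposition
    have h1 : MeasurePreserving (Prod.map e b) (volume : Measure (ℝ × En k))
        (volume : Measure ((ℝ ∙ u) × (ℝ ∙ u)ᗮ)) :=
      e.measurePreserving.prod b.measurePreserving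
    have h2 := (o.symm.measurePreserving.comp
      (WithLp.volume_preserving_toLp (ℝ ∙ u) (ℝ ∙ u)ᗮ)).comp h1
    have h3 : (fun p : ℝ × En k => p.1 • u + ι p.2) =
        (o.symm ∘ WithLp.toLp 2) ∘ Prod.map e b := by
      ext1 q
      rfl
    rw [h3]
    exact h2

theorem exists_hausdorffMeasure_eq_smul_volume (k : ℕ) :
    ∃ κ : ℝ≥0∞, κ ≠ 0 ∧ κ ≠ ⊤ ∧ (μH[(k : ℝ)] : Measure (En k)) = κ • volume := by
  have h : (μH[(k : ℝ)] : Measure (En k)).IsAddHaarMeasure := by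
    have := isAddHaarMeasure_hausdorffMeasure (E := En k)
    simpa using this
  have h2 := Measure.isAddLeftInvariant_eq_smul (μH[(k : ℝ)] : Measure (En k)) volume
  set c := Measure.addHaarScalarFactor (μH[(k : ℝ)] : Measure (En k)) volume with hc
  refine ⟨c, ?_, by simp, h2⟩
  have := Measure.addHaarScalarFactor_pos_of_isAddHaarMeasure (μH[(k : ℝ)] : Measure (En k)) volume
  rw [← hc] at this
  exact_mod_cast this.ne'

/-- The ratio between Hausdorff measure and Lebesgue measure in dimension `k`. -/
def hausdorffRatio (k : ℕ) : ℝ≥0∞ := (exists_hausdorffMeasure_eq_smul_volume k).choose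

theorem hausdorffRatio_ne_zero (k : ℕ) : hausdorffRatio k ≠ 0 :=
  (exists_hausdorffMeasure_eq_smul_volume k).choose_spec.1

theorem hausdorffRatio_ne_top (k : ℕ) : hausdorffRatio k ≠ ⊤ :=
  (exists_hausdorffMeasure_eq_smul_volume k).choose_spec.2.1

theorem hausdorffMeasure_eq_hausdorffRatio_smul (k : ℕ) :
    (μH[(k : ℝ)] : Measure (En k)) = hausdorffRatio k • volume :=
  (exists_hausdorffMeasure_eq_smul_volume k).choose_spec.2.2

/-- Hausdorff measure of a subset of a hyperplane, computed in a chart. -/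
theorem hausdorffMeasure_of_subset_hyperplane {k : ℕ} {u : En (k + 1)}
    (ι : En k →ₗᵢ[ℝ] En (k + 1))
    (hdec : ∀ x, ∃ w, x = ⟪x, u⟫_ℝ • u + ι w) {S : Set (En (k + 1))} {h : ℝ}
    (hS : ∀ x ∈ S, ⟪x, u⟫_ℝ = h) :
    μH[(k : ℝ)] S = hausdorffRatio k * volume {w | h • u + ι w ∈ S} := by
  have himg : S = (fun w => h • u + ι w) '' {w | h • u + ι w ∈ S} := by
    ext x
    constructor
    · intro hx
      obtain ⟨w, hw⟩ := hdec x
      rw [hS x hx] at hw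
      refine ⟨w, ?_, hw.symm⟩
      rw [Set.mem_ofPred_eq, ← hw]
      exact hx
    · rintro ⟨w, hw, rfl⟩
      exact hw
  have hiso : Isometry (fun w => h • u + ι w) :=
    (IsometryEquiv.addLeft (h • u)).isometry.comp ι.isometry
  calc μH[(k : ℝ)] S = μH[(k : ℝ)] ((fun w => h • u + ι w) '' {w | h • u + ι w ∈ S}) := by
        rw [← himg]
    _ = _ := by
        rw [hiso.hausdorffMeasure_image (Or.inl (Nat.cast_nonneg k)),
          hausdorffMeasure_eq_hausdorffRatio_smul]
        rfl

theorem hausdorffMeasure_lt_top_of_subset_hyperplane {k : ℕ} {u : En (k + 1)} (hu : ‖u‖ = 1)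
    {S : Set (En (k + 1))} (hb : Bornology.IsBounded S) {h : ℝ}
    (hS : ∀ x ∈ S, ⟪x, u⟫_ℝ = h) : μH[(k : ℝ)] S < ⊤ := by
  obtain ⟨ι, -, hdec, -⟩ := exists_hyperplane_chart hu
  rw [hausdorffMeasure_of_subset_hyperplane ι hdec hS]
  refine ENNReal.mul_lt_top (hausdorffRatio_ne_top k).lt_top ?_
  have hiso : Isometry (fun w => h • u + ι w) :=
    (IsometryEquiv.addLeft (h • u)).isometry.comp ι.isometry
  exact (hiso.antilipschitz.isBounded_preimage hb).measure_lt_top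

/-- A set meeting every line in direction `u` over a ball has positive Hausdorff measure. -/
theorem hausdorffMeasure_pos_of_meets_lines {k : ℕ} {u p : En (k + 1)}
    (ι : En k →ₗᵢ[ℝ] En (k + 1)) (hι : ∀ w, ⟪ι w, u⟫_ℝ = 0) {S : Set (En (k + 1))} {δ : ℝ}
    (hδ : 0 < δ) (hS : ∀ w ∈ ball (0 : En k) δ, ∃ s : ℝ, p + ι w + s • u ∈ S) :
    0 < μH[(k : ℝ)] S := by
  let T : En (k + 1) →L[ℝ] En k := ContinuousLinearMap.adjoint ι.toContinuousLinearMap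
  have hTι : ∀ w, T (ι w) = w := by
    intro w
    refine ext_inner_right ℝ fun z => ?_
    rw [ContinuousLinearMap.adjoint_inner_left]
    exact ι.inner_map_map w z
  have hTu : T u = 0 := by
    refine ext_inner_right ℝ fun z => ?_
    rw [ContinuousLinearMap.adjoint_inner_left, real_inner_comm, inner_zero_left]
    exact hι z
  have hTn : ‖T‖ ≤ 1 := by
    rw [LinearIsometryEquiv.norm_map]
    exact ι.norm_toContinuousLinearMap_le
  have hL : LipschitzWith 1 T := T.lipschitz.weaken hTn
  have hsub : (fun w => T p + w) '' ball (0 : En k) δ ⊆ T '' S := by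
    rintro _ ⟨w, hw, rfl⟩
    obtain ⟨s, hs⟩ := hS w hw
    refine ⟨_, hs, ?_⟩
    simp [hTι, hTu]
  have h1 : 0 < μH[(k : ℝ)] ((fun w => T p + w) '' ball (0 : En k) δ) := by
    rw [hausdorffMeasure_eq_hausdorffRatio_smul, Measure.smul_apply, smul_eq_mul]
    refine ENNReal.mul_pos (hausdorffRatio_ne_zero k) ?_
    rw [Set.image_add_left, measure_preimage_add]
    exact (measure_ball_pos volume _ hδ).ne'
  have h2 := hL.hausdorffMeasure_image_le (Nat.cast_nonneg k) S
  simp only [ENNReal.coe_one, ENNReal.one_rpow, one_mul] at h2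
  exact h1.trans_le ((measure_mono hsub).trans h2)

/-- The support function of a set. -/
def supportFn {n : ℕ} (K : Set (En n)) (u : En n) : ℝ := sSup ((fun y => ⟪y, u⟫_ℝ) '' K)

/-- The set `τ(K, ω)` of boundary points of `K` with an outer normal in `ω`. -/
def reverseGauss {n : ℕ} (K : Set (En n)) (ω : Set (Sph n)) : Set (En n) :=
  {x ∈ frontier K | ∃ u ∈ ω, ∀ y ∈ K, ⟪y - x, (u : En n)⟫_ℝ ≤ 0}

/-- The face of `K` with outer normal `u`. -/
def face {n : ℕ} (K : Set (En n)) (u : En n) : Set (En n) := {x ∈ K | ⟪x, u⟫_ℝ = supportFn K u}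

/-- `μ` is the surface area measure of the full-dimensional body `K`. -/
def HasSurfaceArea {k : ℕ} (K : Set (En (k + 1))) (μ : Measure (Sph (k + 1))) : Prop :=
  ∀ ω : Set (Sph (k + 1)), MeasurableSet ω → μ ω = μH[(k : ℝ)] (reverseGauss K ω)

section Support

variable {n : ℕ} {K : Set (En n)}

theorem inner_le_supportFn (hK : IsCompact K) {x : En n} (hx : x ∈ K) (u : En n) :
    ⟪x, u⟫_ℝ ≤ supportFn K u :=
  le_csSup (hK.image (by fun_prop)).bddAbove ⟨x, hx, rfl⟩

theorem supportFn_le (hne : K.Nonempty) {u : En n} {c : ℝ} (h : ∀ x ∈ K, ⟪x, u⟫_ℝ ≤ c) :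
    supportFn K u ≤ c := by
  refine csSup_le (hne.image _) ?_
  rintro _ ⟨x, hx, rfl⟩
  exact h x hx

theorem inner_lt_of_mem_interior {u p : En n} {c : ℝ} (hu : u ≠ 0) (hp : p ∈ interior K)
    (h : ∀ x ∈ K, ⟪x, u⟫_ℝ ≤ c) : ⟪p, u⟫_ℝ < c := by
  have hev : ∀ᶠ t : ℝ in 𝓝[>] 0, p + t • u ∈ interior K := by
    apply Filter.Eventually.filter_mono nhdsWithin_le_nhds
    have hc : ContinuousAt (fun t : ℝ => p + t • u) 0 := by fun_prop
    apply hc.eventually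
    simpa using isOpen_interior.mem_nhds hp
  obtain ⟨t, ht, ht0⟩ := (hev.and self_mem_nhdsWithin).exists
  have h1 := h _ (interior_subset ht)
  rw [inner_add_left, inner_smul_left, real_inner_self_eq_norm_sq] at h1
  have h2 : 0 < t * ‖u‖ ^ 2 := mul_pos ht0 (by positivity)
  simp only [conj_trivial] at h1
  linarith

theorem inner_lt_supportFn_of_mem_interior (hK : IsCompact K) {u p : En n} (hu : u ≠ 0)
    (hp : p ∈ interior K) : ⟪p, u⟫_ℝ < supportFn K u :=
  inner_lt_of_mem_interior hu hp fun _ hx => inner_le_supportFn hK hx u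

theorem mem_face_iff (hK : IsCompact K) {u : En n} (hu : u ≠ 0) {x : En n} :
    x ∈ face K u ↔ x ∈ frontier K ∧ ∀ y ∈ K, ⟪y - x, u⟫_ℝ ≤ 0 := by
  rw [hK.isClosed.frontier_eq]
  constructor
  · rintro ⟨hx, hxu⟩
    refine ⟨⟨hx, fun hi => ?_⟩, fun y hy => ?_⟩
    · exact (inner_lt_supportFn_of_mem_interior hK hu hi).ne hxu
    · rw [inner_sub_left, hxu]
      linarith [inner_le_supportFn hK hy u]
  · rintro ⟨⟨hx, -⟩, h⟩
    refine ⟨hx, le_antisymm (inner_le_supportFn hK hx u) (supportFn_le ⟨x, hx⟩ fun y hy => ?_)⟩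
    have := h y hy
    rw [inner_sub_left] at this
    linarith

theorem sph_ne_zero (u : Sph n) : (u : En n) ≠ 0 := by
  intro h
  have := norm_eq_of_mem_sphere u
  rw [h] at this
  simp at this

theorem sph_norm (u : Sph n) : ‖(u : En n)‖ = 1 := norm_eq_of_mem_sphere u

theorem reverseGauss_singleton (hK : IsCompact K) (u : Sph n) :
    reverseGauss K {u} = face K u := by
  ext x
  rw [mem_face_iff hK (sph_ne_zero u)]
  simp [reverseGauss]

theorem reverseGauss_union (ω ω' : Set (Sph n)) :
    reverseGauss K (ω ∪ ω') = reverseGauss K ω ∪ reverseGauss K ω' := by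
  ext x
  simp only [reverseGauss, Set.mem_ofPred_eq, Set.mem_union]
  constructor
  · rintro ⟨hx, u, hu | hu, h⟩
    exacts [Or.inl ⟨hx, u, hu, h⟩, Or.inr ⟨hx, u, hu, h⟩]
  · rintro (⟨hx, u, hu, h⟩ | ⟨hx, u, hu, h⟩)
    exacts [⟨hx, u, Or.inl hu, h⟩, ⟨hx, u, Or.inr hu, h⟩]

theorem isCompact_face (hK : IsCompact K) (u : En n) : IsCompact (face K u) := by
  have : face K u = K ∩ {x | ⟪x, u⟫_ℝ = supportFn K u} := rfl
  rw [this]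
  exact hK.inter_right (isClosed_eq (by fun_prop) continuous_const)

theorem exists_unit_normal (hconv : Convex ℝ K) (hint : (interior K).Nonempty) {x : En n}
    (hx : x ∈ frontier K) : ∃ u : Sph n, ∀ y ∈ K, ⟪y - x, (u : En n)⟫_ℝ ≤ 0 := by
  obtain ⟨f, hf⟩ := geometric_hahn_banach_open_point hconv.interior isOpen_interior hx.2
  let g := (InnerProductSpace.toDual ℝ (En n)).symm f
  have hg : ∀ y, f y = ⟪y, g⟫_ℝ := fun y => by
    rw [real_inner_comm, InnerProductSpace.toDual_symm_apply]
  have hg0 : g ≠ 0 := by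
    intro h0
    obtain ⟨p, hp⟩ := hint
    have := hf p hp
    simp [hg, h0] at this
  have hcl : ∀ y ∈ K, ⟪y, g⟫_ℝ ≤ ⟪x, g⟫_ℝ := by
    have hc : closure (interior K) ⊆ {y | ⟪y, g⟫_ℝ ≤ ⟪x, g⟫_ℝ} := by
      refine closure_minimal ?_ (isClosed_le (by fun_prop) continuous_const)
      intro y hy
      have := hf y hy
      rw [hg, hg] at this
      exact this.le
    rw [hconv.closure_interior_eq_closure_of_nonempty_interior hint] at hc
    exact fun y hy => hc (subset_closure hy)
  refine ⟨⟨‖g‖⁻¹ • g, by simp [norm_smul, norm_ne_zero_iff.2 hg0]⟩, fun y hy => ?_⟩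
  rw [inner_smul_right, inner_sub_left]
  exact mul_nonpos_of_nonneg_of_nonpos (by positivity) (by linarith [hcl y hy])

theorem exists_mem_segment_frontier {a b : En n} (ha : a ∈ K) (hb : b ∉ K) :
    ∃ z ∈ segment ℝ a b, z ∈ frontier K := by
  have hpre : IsPreconnected (segment ℝ a b) := (convex_segment a b).isPreconnected
  by_contra! h
  have hcov : segment ℝ a b ⊆ interior K ∪ (closure K)ᶜ := by
    intro z hz
    by_cases hzi : z ∈ interior K
    · exact Or.inl hzi
    · refine Or.inr fun hzc => h z hz ⟨hzc, hzi⟩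
  have hdis : segment ℝ a b ∩ (interior K ∩ (closure K)ᶜ) = ∅ := by
    ext z
    simp only [Set.mem_inter_iff, Set.mem_compl_iff, Set.mem_empty_iff_false, iff_false, not_and,
      not_not]
    exact fun _ hz => subset_closure (interior_subset hz)
  rcases isPreconnected_iff_subset_of_disjoint.1 hpre _ _ isOpen_interior
    isClosed_closure.isOpen_compl hcov hdis with h1 | h1
  · exact hb (interior_subset (h1 (right_mem_segment ℝ a b)))
  · exact h1 (left_mem_segment ℝ a b) (subset_closure ha)

end Support

theorem measure_singleton_of_hasSurfaceArea {k : ℕ} {K : Set (En (k + 1))}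
    {μ : Measure (Sph (k + 1))} (hK : IsCompact K) (hμ : HasSurfaceArea K μ) (u : Sph (k + 1)) :
    μ {u} = μH[(k : ℝ)] (face K u) := by
  rw [hμ _ (measurableSet_singleton u), reverseGauss_singleton hK]

/-- A body is cut out by the support halfspaces of any finite set of directions carrying
its surface area measure. -/
theorem halfspaces_subset_of_hasSurfaceArea {k : ℕ} {K : Set (En (k + 1))}
    {μ : Measure (Sph (k + 1))} (hconv : Convex ℝ K) (hK : IsCompact K)
    (hint : (interior K).Nonempty) (hμ : HasSurfaceArea K μ) (U : Finset (Sph (k + 1)))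
    (hU : μ (U : Set (Sph (k + 1)))ᶜ = 0) :
    {x : En (k + 1) | ∀ u ∈ U, ⟪x, (u : En (k + 1))⟫_ℝ ≤ supportFn K u} ⊆ K := by
  intro q hq
  by_contra hqK
  obtain ⟨p, hp⟩ := hint
  let W : Set (En (k + 1)) := ⋂ u ∈ U, {x | ⟪x, (u : En (k + 1))⟫_ℝ < supportFn K u}
  have hWo : IsOpen W := isOpen_biInter_finset fun u _ => isOpen_lt (by fun_prop) continuous_const
  have hWc : Convex ℝ W := convex_iInter₂ fun u _ =>
    convex_halfSpace_lt (f := fun x => ⟪x, (u : En (k + 1))⟫_ℝ)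
      ⟨fun x y => inner_add_left _ _ _, fun c x => real_inner_smul_left _ _ _⟩ _
  have hmemW : ∀ x, x ∈ W ↔ ∀ u ∈ U, ⟪x, (u : En (k + 1))⟫_ℝ < supportFn K u := by
    intro x
    simp [W]
  have hpW : p ∈ W := (hmemW p).2 fun u _ =>
    inner_lt_supportFn_of_mem_interior hK (sph_ne_zero u) hp
  obtain ⟨q', hq'K, hq'W⟩ : ∃ q', q' ∉ K ∧ q' ∈ W := by
    have hev : ∀ᶠ t : ℝ in 𝓝[>] 0, q + t • (p - q) ∈ Kᶜ := by
      apply Filter.Eventually.filter_mono nhdsWithin_le_nhds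
      have hc : ContinuousAt (fun t : ℝ => q + t • (p - q)) 0 := by fun_prop
      apply hc.eventually
      simp only [zero_smul, add_zero]
      exact hK.isClosed.isOpen_compl.mem_nhds hqK
    obtain ⟨t, ht, ht0, ht1⟩ := (hev.and (Ioo_mem_nhdsGT zero_lt_one)).exists
    refine ⟨_, ht, (hmemW _).2 fun u hu => ?_⟩
    have h1 := hq u hu
    have h2 := (hmemW p).1 hpW u hu
    rw [inner_add_left, real_inner_smul_left, inner_sub_left]
    have h3 := mul_pos ht0 (sub_pos.2 h2)
    have h4 := mul_nonneg (sub_pos.2 ht1).le (sub_nonneg.2 h1)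
    linarith
  have hne : q' - p ≠ 0 := by
    intro h
    rw [sub_eq_zero] at h
    exact hq'K (h ▸ interior_subset hp)
  have hn0 : ‖q' - p‖ ≠ 0 := norm_ne_zero_iff.2 hne
  have he : ‖‖q' - p‖⁻¹ • (q' - p)‖ = 1 := by
    rw [norm_smul, norm_inv, norm_norm, inv_mul_cancel₀ hn0]
  obtain ⟨ι, hι, -, -⟩ := exists_hyperplane_chart he
  have hO : IsOpen ({w | p + ι w ∈ interior K ∩ W} ∩ {w | q' + ι w ∈ Kᶜ ∩ W}) :=
    ((isOpen_interior.inter hWo).preimage (by fun_prop)).inter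
      ((hK.isClosed.isOpen_compl.inter hWo).preimage (by fun_prop))
  obtain ⟨δ, hδ, hball⟩ := Metric.isOpen_iff.1 hO 0 (by simp [hp, hpW, hq'K, hq'W])
  have hpos : 0 < μH[(k : ℝ)] (reverseGauss K (U : Set (Sph (k + 1)))ᶜ) := by
    refine hausdorffMeasure_pos_of_meets_lines (p := p) ι hι hδ fun w hw => ?_
    obtain ⟨⟨hpi, hpw⟩, hqi, hqw⟩ := hball hw
    obtain ⟨z, hz, hzf⟩ := exists_mem_segment_frontier (interior_subset hpi) hqi
    have hzW := hWc.segment_subset hpw hqw hz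
    rw [segment_eq_image'] at hz
    obtain ⟨t, -, rfl⟩ := hz
    refine ⟨t * ‖q' - p‖, ?_⟩
    have hz' : p + ι w + (t * ‖q' - p‖) • ‖q' - p‖⁻¹ • (q' - p) =
        p + ι w + t • (q' + ι w - (p + ι w)) := by
      rw [smul_smul, mul_assoc, mul_inv_cancel₀ hn0]
      module
    rw [hz']
    obtain ⟨u, hu⟩ := exists_unit_normal hconv ⟨p, hp⟩ hzf
    refine ⟨hzf, u, fun huU => ?_, hu⟩
    have h1 := (mem_face_iff hK (sph_ne_zero u)).2 ⟨hzf, hu⟩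
    exact ((hmemW _).1 hzW u huU).ne h1.2
  rw [← hμ _ U.measurableSet.compl, hU] at hpos
  exact lt_irrefl _ hpos

/-- `f` is given by a real polynomial of total degree at most `d`. -/
def IsPolyFun {n : ℕ} (d : ℕ) (f : En n → ℝ) : Prop :=
  ∃ p : MvPolynomial (Fin n) ℝ, p.totalDegree ≤ d ∧
    ∀ x : En n, MvPolynomial.eval (fun i => x i) p = f x

namespace IsPolyFun

variable {n d e : ℕ} {f g : En n → ℝ}

theorem mono (hf : IsPolyFun d f) (h : d ≤ e) : IsPolyFun e f := by
  obtain ⟨p, hp, hpf⟩ := hf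
  exact ⟨p, hp.trans h, hpf⟩

theorem mul (hf : IsPolyFun d f) (hg : IsPolyFun e g) :
    IsPolyFun (d + e) (fun x => f x * g x) := by
  obtain ⟨p, hp, hpf⟩ := hf
  obtain ⟨q, hq, hqg⟩ := hg
  exact ⟨p * q, (MvPolynomial.totalDegree_mul p q).trans (add_le_add hp hq), fun x => by
    rw [map_mul, hpf, hqg]⟩

theorem prod {ι : Type*} (s : Finset ι) {F : ι → En n → ℝ} (h : ∀ i ∈ s, IsPolyFun 1 (F i)) :
    IsPolyFun s.card (fun x => ∏ i ∈ s, F i x) := by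
  classical
  induction s using Finset.induction_on with
  | empty => exact ⟨1, by simp, by simp⟩
  | insert a s ha ih =>
    have h1 := (h a (Finset.mem_insert_self a s)).mul
      (ih fun i hi => h i (Finset.mem_insert_of_mem hi))
    simp only [Finset.prod_insert ha, Finset.card_insert_of_notMem ha]
    exact h1.mono (by omega)

theorem affineMap (f : En n →ᵃ[ℝ] ℝ) : IsPolyFun 1 f := by
  refine ⟨∑ i, MvPolynomial.C (f.linear (EuclideanSpace.single i 1)) * MvPolynomial.X i +
    MvPolynomial.C (f 0), ?_, fun x => ?_⟩
  · refine (MvPolynomial.totalDegree_add _ _).trans (max_le ?_ (by simp))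
    refine (MvPolynomial.totalDegree_finsetSum _ _).trans (Finset.sup_le fun i _ => ?_)
    refine (MvPolynomial.totalDegree_mul _ _).trans ?_
    simp
  · have hx : x = ∑ i, x i • EuclideanSpace.single i (1 : ℝ) := by
      have := (EuclideanSpace.basisFun (Fin n) ℝ).sum_repr x
      simpa using this.symm
    have h1 : f x = f.linear x + f 0 := congrFun f.decomp x
    rw [h1]
    conv_rhs => rw [hx]
    simp [map_sum, mul_comm]

theorem one_sub_inner (v : En n) : IsPolyFun 1 (fun x => 1 - ⟪x, v⟫_ℝ) := by
  have h := affineMap (AffineMap.const ℝ (En n) (1 : ℝ) -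
    ((innerSL ℝ v).toLinearMap.toAffineMap : En n →ᵃ[ℝ] ℝ))
  convert h using 2 with x
  simp [real_inner_comm]

theorem continuous (hf : IsPolyFun d f) : Continuous f := by
  obtain ⟨p, -, hpf⟩ := hf
  have : f = fun x : En n => MvPolynomial.eval (fun i => x i) p := funext fun x => (hpf x).symm
  rw [this]
  exact (MvPolynomial.continuous_eval p).comp (by fun_prop)

end IsPolyFun

theorem integrable_sphere {n : ℕ} (μ : Measure (Sph n)) [IsFiniteMeasure μ] {f : En n → ℝ}
    (hf : Continuous f) : Integrable (fun u : Sph n => f u) μ := by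
  have hc : Continuous (fun u : Sph n => f u) := hf.comp continuous_subtype_val
  exact hc.integrable_of_hasCompactSupport (HasCompactSupport.of_compactSpace _)

theorem IsPolyFun.integral_eq {n d : ℕ} {f : En n → ℝ} (hf : IsPolyFun d f)
    {μ ν : Measure (Sph n)} [IsFiniteMeasure μ] [IsFiniteMeasure ν]
    (hmom : ∀ i : Fin n → ℕ, (∑ j, i j) ≤ d → sphMoment ν i = sphMoment μ i) :
    ∫ u, f u ∂ν = ∫ u, f u ∂μ := by
  obtain ⟨p, hp, hpf⟩ := hf
  have key : ∀ (ρ : Measure (Sph n)) [IsFiniteMeasure ρ],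
      ∫ u, f u ∂ρ = ∑ i ∈ p.support, p.coeff i * sphMoment ρ i := by
    intro ρ _
    simp_rw [← hpf, MvPolynomial.eval_eq']
    rw [integral_finsetSum]
    · simp_rw [integral_const_mul]
      rfl
    · intro i _
      exact (integrable_sphere ρ (f := fun x : En n => ∏ j, x j ^ i j) (by fun_prop)).const_mul _
  rw [key ν, key μ]
  refine Finset.sum_congr rfl fun i hi => ?_
  rw [hmom]
  refine le_trans ?_ ((MvPolynomial.le_totalDegree hi).trans hp)
  rw [Finsupp.sum_fintype _ _ fun _ => rfl]

theorem integral_eq_sum_of_compl_null {n : ℕ} {μ : Measure (Sph n)} [IsFiniteMeasure μ]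
    {U : Finset (Sph n)} (hU : μ (U : Set (Sph n))ᶜ = 0) {f : En n → ℝ} (hf : Continuous f) :
    ∫ u, f u ∂μ = ∑ u ∈ U, μ.real {u} * f u := by
  have h1 : μ.restrict (U : Set (Sph n)) = μ :=
    Measure.restrict_eq_self_of_ae_mem (by
      rw [ae_iff]
      exact hU)
  have h2 := setIntegral_finset (μ := μ) U (f := fun u : Sph n => f u)
    (integrable_sphere μ hf).integrableOn
  rw [h1] at h2
  simpa using h2

/-- A finite measure on the sphere supported on finitely many affinely spanning points is
determined by its moments of low order. -/
theorem eq_of_moments_eq {n m : ℕ} (hm : n + 1 ≤ m) {μ ν : Measure (Sph n)} [IsFiniteMeasure μ]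
    [IsFiniteMeasure ν] (U : Finset (Sph n)) (hcard : U.card ≤ m)
    (hspan : affineSpan ℝ ((fun u : Sph n => (u : En n)) '' (U : Set (Sph n))) = ⊤)
    (hU : μ (U : Set (Sph n))ᶜ = 0)
    (hmom : ∀ i : Fin n → ℕ, (∑ j, i j) ≤ m - n + 2 → sphMoment ν i = sphMoment μ i) :
    ν = μ := by
  classical
  obtain ⟨t, htU, hts, hti⟩ := exists_affineIndependent ℝ (En n)
    ((fun u : Sph n => (u : En n)) '' (U : Set (Sph n)))
  rw [hspan] at hts
  have htfin : t.Finite := (U.finite_toSet.image _).subset htU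
  have := htfin.fintype
  let b : AffineBasis t ℝ (En n) := ⟨Subtype.val, hti, by rw [Subtype.range_coe]; exact hts⟩
  have hb : ∀ k : t, b k = k := fun k => rfl
  let R := U.filter fun u : Sph n => (u : En n) ∉ t
  have hRcard : R.card + (n + 1) = U.card := by
    have h1 := U.card_filter_add_card_filter_not (fun u : Sph n => (u : En n) ∈ t)
    have h2 : (U.filter fun u : Sph n => (u : En n) ∈ t).card = n + 1 := by
      have h3 := b.card_eq_finrank_add_one
      rw [finrank_euclideanSpace_fin] at h3
      rw [← h3, ← Set.toFinset_card]
      refine Finset.card_bij (fun (u : Sph n) _ => (u : En n)) ?_ ?_ ?_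
      · intro u hu
        simpa using (Finset.mem_filter.1 hu).2
      · intro u _ u' _ h
        exact Subtype.ext h
      · intro x hx
        rw [Set.mem_toFinset] at hx
        obtain ⟨u, hu, rfl⟩ := htU hx
        exact ⟨u, Finset.mem_filter.2 ⟨hu, hx⟩, rfl⟩
    have h4 : R.card = (U.filter fun u : Sph n => ¬ (u : En n) ∈ t).card := rfl
    omega
  have hpoly : ∀ S : Finset (Sph n),
      IsPolyFun S.card (fun x : En n => ∏ i ∈ S, (1 - ⟪x, (i : En n)⟫_ℝ)) := fun S =>
    IsPolyFun.prod S fun i _ => IsPolyFun.one_sub_inner _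
  have hle : ∀ u v : Sph n, ⟪(u : En n), (v : En n)⟫_ℝ ≤ 1 := fun u v => by
    have := real_inner_le_norm (u : En n) v
    rwa [norm_eq_of_mem_sphere, norm_eq_of_mem_sphere, one_mul] at this
  have hone : ∀ u v : Sph n, 1 - ⟪(u : En n), (v : En n)⟫_ℝ = 0 ↔ u = v := fun u v => by
    rw [sub_eq_zero, eq_comm, inner_eq_one_iff_of_norm_eq_one (norm_eq_of_mem_sphere u)
      (norm_eq_of_mem_sphere v), Subtype.ext_iff]
  have hG0 : ∀ (S : Finset (Sph n)) (u : Sph n),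
      ∏ i ∈ S, (1 - ⟪(u : En n), (i : En n)⟫_ℝ) = 0 ↔ u ∈ S := by
    intro S u
    simp [Finset.prod_eq_zero_iff, hone]
  have hνU : ν (U : Set (Sph n))ᶜ = 0 := by
    have hae : ∀ k : t, ∀ᵐ u : Sph n ∂ν, (b.coord k u * b.coord k u *
        (1 - ⟪(u : En n), (k : En n)⟫_ℝ)) * ∏ i ∈ R, (1 - ⟪(u : En n), (i : En n)⟫_ℝ) = 0 := by
      intro k
      have hP := (((IsPolyFun.affineMap (b.coord k)).mul (IsPolyFun.affineMap (b.coord k))).mul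
        (IsPolyFun.one_sub_inner (k : En n))).mul (hpoly R)
      have hi := (hP.mono (show _ ≤ m - n + 2 by omega)).integral_eq hmom
      rw [integral_eq_sum_of_compl_null hU hP.continuous, Finset.sum_eq_zero] at hi
      · have hkU := htU k.2
        obtain ⟨k', hk', hkk⟩ := hkU
        exact (integral_eq_zero_iff_of_nonneg (fun u => mul_nonneg (mul_nonneg (mul_self_nonneg _)
          (by
            simp only at hkk
            rw [← hkk]
            exact sub_nonneg.2 (hle u k')))
          (Finset.prod_nonneg fun i _ => sub_nonneg.2 (hle u i)))
          (integrable_sphere ν hP.continuous)).1 hi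
      · intro u hu
        by_cases hut : (u : En n) ∈ t
        · by_cases huk : (u : En n) = k
          · have : 1 - ⟪(u : En n), (k : En n)⟫_ℝ = 0 := by
              rw [huk, ← huk, real_inner_self_eq_norm_sq, norm_eq_of_mem_sphere]
              norm_num
            simp [this]
          · have : b.coord k (u : En n) = 0 := by
              have h1 : (u : En n) = b ⟨u, hut⟩ := rfl
              rw [h1]
              refine b.coord_apply_ne fun h => huk ?_
              rw [h]
            simp [this]
        · have : u ∈ R := Finset.mem_filter.2 ⟨hu, hut⟩
          rw [(hG0 R u).2 this]
          simp
    have hall := ae_all_iff.2 hae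
    rw [ae_iff] at hall
    refine measure_mono_null ?_ hall
    intro u hu hcon
    apply hu
    have hsum := b.sum_coord_apply_eq_one (u : En n)
    obtain ⟨k, -, hk⟩ := Finset.exists_ne_zero_of_sum_ne_zero (hsum.trans_ne one_ne_zero)
    rcases mul_eq_zero.1 (hcon k) with h | h
    · rcases mul_eq_zero.1 h with h | h
      · exact absurd (mul_self_eq_zero.1 h) hk
      · obtain ⟨k', hk', hkk⟩ := htU k.2
        simp only at hkk
        rw [← hkk, hone] at h
        rw [h]
        exact hk'
    · exact (Finset.mem_filter.1 ((hG0 R u).1 h)).1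
  have hdiff : ∀ f : En n → ℝ, IsPolyFun (m - n + 2) f →
      ∑ u ∈ U, (ν.real {u} - μ.real {u}) * f u = 0 := by
    intro f hf
    have h := hf.integral_eq hmom
    rw [integral_eq_sum_of_compl_null hU hf.continuous,
      integral_eq_sum_of_compl_null hνU hf.continuous] at h
    simp_rw [sub_mul]
    rw [Finset.sum_sub_distrib, h, sub_self]
  have hmt : ∀ j ∈ U, (j : En n) ∈ t → ν.real {j} = μ.real {j} := by
    intro j hj hjt
    have hP := (IsPolyFun.affineMap (b.coord ⟨j, hjt⟩)).mul (hpoly R)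
    have h := hdiff _ (hP.mono (by omega))
    rw [Finset.sum_eq_single j] at h
    · have hcj : b.coord ⟨j, hjt⟩ (j : En n) = 1 := b.coord_apply_eq ⟨j, hjt⟩
      have hjR : j ∉ R := fun hR => (Finset.mem_filter.1 hR).2 hjt
      rw [hcj, one_mul] at h
      rcases mul_eq_zero.1 h with h | h
      · linarith
      · exact absurd ((hG0 R j).1 h) hjR
    · intro u hu huj
      by_cases hut : (u : En n) ∈ t
      · have : b.coord ⟨j, hjt⟩ (u : En n) = 0 := by
          have h1 : (u : En n) = b ⟨u, hut⟩ := rfl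
          rw [h1]
          refine b.coord_apply_ne fun h => huj ?_
          exact Subtype.ext (congrArg Subtype.val h).symm
        simp [this]
      · have : u ∈ R := Finset.mem_filter.2 ⟨hu, hut⟩
        rw [(hG0 R u).2 this]
        simp
    · exact fun h => absurd hj h
  have hmass : ∀ j ∈ U, ν.real {j} = μ.real {j} := by
    intro j hj
    by_cases hjt : (j : En n) ∈ t
    · exact hmt j hj hjt
    · have hcle : (R.erase j).card ≤ R.card := Finset.card_erase_le
      have h := hdiff _ ((hpoly (R.erase j)).mono (by omega))
      rw [Finset.sum_eq_single j] at h
      · rcases mul_eq_zero.1 h with h | h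
        · linarith
        · exact absurd ((hG0 _ j).1 h) (Finset.notMem_erase j R)
      · intro u hu huj
        by_cases hut : (u : En n) ∈ t
        · rw [hmt u hu hut, sub_self, zero_mul]
        · have : u ∈ R.erase j := Finset.mem_erase.2 ⟨huj, Finset.mem_filter.2 ⟨hu, hut⟩⟩
          rw [(hG0 _ u).2 this, mul_zero]
      · exact fun h => absurd hj h
  have hsum : ∀ (ρ : Measure (Sph n)) [IsFiniteMeasure ρ], ρ (U : Set (Sph n))ᶜ = 0 →
      ∀ s : Set (Sph n), ρ s = ENNReal.ofReal (∑ u ∈ U.filter (· ∈ s), ρ.real {u}) := by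
    intro ρ _ hρ s
    rw [sum_measureReal_singleton, ofReal_measureReal]
    refine le_antisymm ?_ (measure_mono fun u hu => (Finset.mem_filter.1 hu).2)
    refine (measure_mono (t := (U.filter (· ∈ s) : Set (Sph n)) ∪ (U : Set (Sph n))ᶜ) ?_).trans
      ((measure_union_le _ _).trans (by rw [hρ, add_zero]))
    intro u hu
    by_cases huU : u ∈ U
    · exact Or.inl (Finset.mem_coe.2 (Finset.mem_filter.2 ⟨huU, hu⟩))
    · exact Or.inr huU
  refine Measure.ext fun s _ => ?_
  rw [hsum ν hνU, hsum μ hU]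
  congr 1
  exact Finset.sum_congr rfl fun u hu => hmass u (Finset.mem_filter.1 hu).1

theorem hausdorffMeasure_face_lt_top {k : ℕ} {K : Set (En (k + 1))} (hK : IsCompact K)
    (u : Sph (k + 1)) : μH[(k : ℝ)] (face K u) < ⊤ :=
  hausdorffMeasure_lt_top_of_subset_hyperplane (sph_norm u)
    (hK.isBounded.subset fun _ hx => hx.1) fun _ hx => hx.2

/-- Distinct faces overlap in a null set. -/
theorem hausdorffMeasure_face_inter_face {k : ℕ} {K : Set (En (k + 1))}
    {μ : Measure (Sph (k + 1))} (hK : IsCompact K) (hμ : HasSurfaceArea K μ) {u v : Sph (k + 1)}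
    (huv : u ≠ v) : μH[(k : ℝ)] (face K u ∩ face K v) = 0 := by
  have h1 := measure_union_add_inter (μ := μH[(k : ℝ)]) (face K u)
    (isCompact_face hK (v : En (k + 1))).measurableSet
  have h2 : μH[(k : ℝ)] (face K u ∪ face K v) =
      μH[(k : ℝ)] (face K u) + μH[(k : ℝ)] (face K v) := by
    rw [← reverseGauss_singleton hK, ← reverseGauss_singleton hK, ← reverseGauss_union,
      ← hμ _ ((measurableSet_singleton u).union (measurableSet_singleton v)),
      measure_union (Set.disjoint_singleton.2 huv) (measurableSet_singleton v),
      hμ _ (measurableSet_singleton u), hμ _ (measurableSet_singleton v)]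
  rw [h2] at h1
  have h3 := ENNReal.add_lt_top.2 ⟨hausdorffMeasure_face_lt_top hK u,
    hausdorffMeasure_face_lt_top hK v⟩
  exact (ENNReal.add_right_inj h3.ne).1 (h1.trans (add_zero _).symm)

theorem exists_inner_pos_of_halfspaces_subset {n : ℕ} {K : Set (En n)}
    (hK : Bornology.IsBounded K) (hne : K.Nonempty) (U : Finset (Sph n)) {h : Sph n → ℝ}
    (hKU : ∀ x ∈ K, ∀ u ∈ U, ⟪x, (u : En n)⟫_ℝ ≤ h u)
    (hsub : {x : En n | ∀ u ∈ U, ⟪x, (u : En n)⟫_ℝ ≤ h u} ⊆ K) {w : En n} (hw : w ≠ 0) :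
    ∃ u ∈ U, 0 < ⟪w, (u : En n)⟫_ℝ := by
  by_contra! hcon
  obtain ⟨x, hx⟩ := hne
  obtain ⟨C, hC⟩ := hK.exists_norm_le
  have hmem : ∀ t : ℝ, 0 ≤ t → x + t • w ∈ K := by
    intro t ht
    refine hsub fun u hu => ?_
    rw [inner_add_left, real_inner_smul_left]
    have := mul_nonpos_of_nonneg_of_nonpos ht (hcon u hu)
    linarith [hKU x hx u hu]
  have hwn : 0 < ‖w‖ := norm_pos_iff.2 hw
  have hC0 : 0 ≤ C := (norm_nonneg x).trans (hC x hx)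
  have h1 := hC _ (hmem ((2 * C + 1) / ‖w‖) (by positivity))
  have h2 : ‖((2 * C + 1) / ‖w‖) • w‖ = 2 * C + 1 := by
    rw [norm_smul, Real.norm_of_nonneg (by positivity), div_mul_cancel₀ _ hwn.ne']
  have h3 := norm_sub_le (x + ((2 * C + 1) / ‖w‖) • w) x
  rw [add_sub_cancel_left, h2] at h3
  linarith [hC x hx]

/-- A nonempty bounded intersection of `m` halfspaces is the intersection of its support
halfspaces in at most `m` unit directions. -/
theorem exists_support_directions {k m : ℕ} {P : Set (En (k + 1))} (hne : P.Nonempty)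
    (v : Fin m → En (k + 1)) (c : Fin m → ℝ)
    (hPv : P = ⋂ j, {x | ⟪x, v j⟫_ℝ ≤ c j}) :
    ∃ U : Finset (Sph (k + 1)), U.card ≤ m ∧
      {x : En (k + 1) | ∀ u ∈ U, ⟪x, (u : En (k + 1))⟫_ℝ ≤ supportFn P u} ⊆ P := by
  classical
  have hmemP : ∀ x, x ∈ P ↔ ∀ j, ⟪x, v j⟫_ℝ ≤ c j := by
    intro x
    rw [hPv]
    simp
  let u₀ : Sph (k + 1) := ⟨EuclideanSpace.single 0 1, by simp⟩
  let N : Fin m → Sph (k + 1) := fun j => if h : v j = 0 then u₀ else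
    ⟨‖v j‖⁻¹ • v j, by simp [norm_smul, norm_ne_zero_iff.2 h]⟩
  refine ⟨Finset.univ.image N, Finset.card_image_le.trans (by simp), fun x hx => ?_⟩
  rw [hmemP]
  intro j
  by_cases hj : v j = 0
  · obtain ⟨y, hy⟩ := hne
    have := (hmemP y).1 hy j
    rw [hj, inner_zero_right] at this ⊢
    exact this
  · have hvn : 0 < ‖v j‖ := norm_pos_iff.2 hj
    have h1 := hx (N j) (Finset.mem_image_of_mem N (Finset.mem_univ j))
    have h2 : (N j : En (k + 1)) = ‖v j‖⁻¹ • v j := by simp [N, hj]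
    have h3 : supportFn P (N j) ≤ ‖v j‖⁻¹ * c j := by
      refine supportFn_le hne fun y hy => ?_
      rw [h2, real_inner_smul_right]
      exact mul_le_mul_of_nonneg_left ((hmemP y).1 hy j) (by positivity)
    have h4 := h1.trans h3
    rw [h2, real_inner_smul_right] at h4
    exact le_of_mul_le_mul_left h4 (by positivity)

theorem affineSpan_eq_top_of_halfspaces_subset {n : ℕ} {K : Set (En n)}
    (hK : Bornology.IsBounded K) (hne : K.Nonempty) (U : Finset (Sph n)) {h : Sph n → ℝ}
    (hKU : ∀ x ∈ K, ∀ u ∈ U, ⟪x, (u : En n)⟫_ℝ ≤ h u)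
    (hsub : {x : En n | ∀ u ∈ U, ⟪x, (u : En n)⟫_ℝ ≤ h u} ⊆ K) (hn : 0 < n) :
    affineSpan ℝ ((fun u : Sph n => (u : En n)) '' (U : Set (Sph n))) = ⊤ := by
  set s := (fun u : Sph n => (u : En n)) '' (U : Set (Sph n)) with hs
  have hpos := fun w hw => exists_inner_pos_of_halfspaces_subset hK hne U hKU hsub (w := w) hw
  have hsne : s.Nonempty := by
    obtain ⟨u, hu, -⟩ := hpos (EuclideanSpace.single ⟨0, hn⟩ 1) (by simp)
    exact ⟨u, u, hu, rfl⟩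
  rw [← AffineSubspace.direction_eq_top_iff_of_nonempty ((affineSpan_nonempty ℝ).2 hsne)]
  by_contra hcon
  have hbot : (affineSpan ℝ s).directionᗮ ≠ ⊥ := fun h =>
    hcon ((Submodule.orthogonal_eq_bot_iff).1 h)
  obtain ⟨w, hw, hw0⟩ := Submodule.exists_mem_ne_zero_of_ne_bot hbot
  obtain ⟨u, hu, hu'⟩ := hpos w hw0
  obtain ⟨u', hv, hv'⟩ := hpos (-w) (neg_ne_zero.2 hw0)
  have hd : (u : En n) -ᵥ (u' : En n) ∈ (affineSpan ℝ s).direction :=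
    AffineSubspace.vsub_mem_direction (subset_affineSpan ℝ s ⟨u, hu, rfl⟩)
      (subset_affineSpan ℝ s ⟨u', hv, rfl⟩)
  have h1 := Submodule.inner_right_of_mem_orthogonal hd hw
  rw [vsub_eq_sub, inner_sub_left, real_inner_comm, real_inner_comm w] at h1
  rw [inner_neg_left] at hv'
  linarith

/-- A boundary point whose normal is not among the facet directions lies in two facets. -/
theorem reverseGauss_compl_subset {n : ℕ} {P : Set (En n)} (hP : IsCompact P)
    (U : Finset (Sph n))
    (hsub : {x : En n | ∀ u ∈ U, ⟪x, (u : En n)⟫_ℝ ≤ supportFn P u} ⊆ P) :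
    reverseGauss P (U : Set (Sph n))ᶜ ⊆
      ⋃ p ∈ U.offDiag, face P (p.1 : En n) ∩ face P (p.2 : En n) := by
  rintro x ⟨hxf, u, huU, hu⟩
  have hxP : x ∈ P := hP.isClosed.frontier_subset hxf
  have hdir : ∀ d : En n, (∀ a ∈ U, ⟪x, (a : En n)⟫_ℝ = supportFn P a → ⟪d, (a : En n)⟫_ℝ ≤ 0) →
      ⟪d, (u : En n)⟫_ℝ ≤ 0 := by
    intro d hd
    have hev : ∀ᶠ t : ℝ in 𝓝[>] 0, ∀ a ∈ U, ⟪x + t • d, (a : En n)⟫_ℝ ≤ supportFn P a := by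
      rw [Filter.eventually_all_finset]
      intro a ha
      rcases (inner_le_supportFn hP hxP (a : En n)).eq_or_lt with heq | hlt
      · filter_upwards [self_mem_nhdsWithin] with t ht
        rw [inner_add_left, real_inner_smul_left]
        have := mul_nonpos_of_nonneg_of_nonpos (le_of_lt ht) (hd a ha heq)
        linarith
      · apply Filter.Eventually.filter_mono nhdsWithin_le_nhds
        have hc : ContinuousAt (fun t : ℝ => ⟪x + t • d, (a : En n)⟫_ℝ) 0 := by fun_prop
        refine (hc.eventually_lt continuousAt_const ?_).mono fun t ht => le_of_lt ht
        simpa using hlt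
    obtain ⟨t, ht, ht0⟩ := (hev.and self_mem_nhdsWithin).exists
    have := hu _ (hsub ht)
    rw [add_sub_cancel_left, real_inner_smul_left] at this
    exact nonpos_of_mul_nonpos_right this ht0
  have huu : ⟪(u : En n), (u : En n)⟫_ℝ = 1 := by
    rw [real_inner_self_eq_norm_sq, sph_norm]
    norm_num
  obtain ⟨a, haU, ha⟩ : ∃ a ∈ U, ⟪x, (a : En n)⟫_ℝ = supportFn P a := by
    by_contra! hcon
    have := hdir u fun a ha h => absurd h (hcon a ha)
    linarith
  obtain ⟨b, hbU, hb, hba⟩ : ∃ b ∈ U, ⟪x, (b : En n)⟫_ℝ = supportFn P b ∧ b ≠ a := by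
    by_contra! hcon
    have hle : ⟪(u : En n), (a : En n)⟫_ℝ ≤ 1 := by
      have := real_inner_le_norm (u : En n) a
      rwa [sph_norm, sph_norm, one_mul] at this
    have h1 := hdir (u - a) fun b hb h => by
      rw [hcon b hb h, inner_sub_left, real_inner_self_eq_norm_sq (a : En n), sph_norm]
      linarith
    rw [inner_sub_left, huu, real_inner_comm] at h1
    have h2 := (inner_eq_one_iff_of_norm_eq_one (sph_norm u) (sph_norm a)).1
      (le_antisymm hle (by linarith))
    exact huU (Subtype.ext h2 ▸ haU)
  simp only [Set.mem_iUnion]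
  exact ⟨(a, b), Finset.mem_offDiag.2 ⟨haU, hbU, hba.symm⟩, ⟨hxP, ha⟩, hxP, hb⟩

theorem surfaceArea_compl_eq_zero {k : ℕ} {P : Set (En (k + 1))} {μ : Measure (Sph (k + 1))}
    (hP : IsCompact P) (hμ : HasSurfaceArea P μ) (U : Finset (Sph (k + 1)))
    (hsub : {x : En (k + 1) | ∀ u ∈ U, ⟪x, (u : En (k + 1))⟫_ℝ ≤ supportFn P u} ⊆ P) :
    μ (U : Set (Sph (k + 1)))ᶜ = 0 := by
  rw [hμ _ U.measurableSet.compl]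
  refine measure_mono_null (reverseGauss_compl_subset hP U hsub) ?_
  refine (measure_biUnion_null_iff U.offDiag.countable_toSet).2 fun p hp => ?_
  exact hausdorffMeasure_face_inter_face hP hμ (Finset.mem_offDiag.1 hp).2.2

theorem surfaceArea_singleton_lt_top {k : ℕ} {P : Set (En (k + 1))} {μ : Measure (Sph (k + 1))}
    (hP : IsCompact P) (hμ : HasSurfaceArea P μ) (u : Sph (k + 1)) : μ {u} < ⊤ := by
  rw [measure_singleton_of_hasSurfaceArea hP hμ]
  exact hausdorffMeasure_face_lt_top hP u

theorem isFiniteMeasure_of_hasSurfaceArea {k : ℕ} {P : Set (En (k + 1))}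
    {μ : Measure (Sph (k + 1))} (hP : IsCompact P) (hμ : HasSurfaceArea P μ)
    (U : Finset (Sph (k + 1))) (hU : μ (U : Set (Sph (k + 1)))ᶜ = 0) : IsFiniteMeasure μ := by
  refine ⟨?_⟩
  rw [← measure_add_measure_compl U.measurableSet, hU, add_zero, ← sum_measure_singleton]
  exact ENNReal.sum_lt_top.2 fun u _ => surfaceArea_singleton_lt_top hP hμ u

theorem IsSurfaceAreaMeasure.hasSurfaceArea {k : ℕ} {K : Set (En (k + 1))}
    {μ : Measure (Sph (k + 1))} (h : IsSurfaceAreaMeasure K μ) (hint : (interior K).Nonempty) :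
    HasSurfaceArea K μ := by
  have hk : ((k + 1 : ℕ) : ℝ) - 1 = k := by
    push_cast
    ring
  rcases h with ⟨-, h⟩ | ⟨h, -⟩
  · rw [hk] at h
    exact h
  · rw [h] at hint
    exact absurd hint Set.not_nonempty_empty

theorem interior_nonempty_of_common_surfaceArea {k : ℕ} (hk : 1 ≤ k) {P K : Set (En (k + 1))}
    {μ : Measure (Sph (k + 1))} (hPconv : Convex ℝ P) (hP : IsCompact P)
    (hPint : (interior P).Nonempty) (hμP : HasSurfaceArea P μ) (hμK : IsSurfaceAreaMeasure K μ) :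
    (interior K).Nonempty := by
  classical
  rcases hμK with ⟨h, -⟩ | ⟨-, u, u', huu, -, hμ⟩
  · exact h
  have hnull : μ (({u, u'} : Finset (Sph (k + 1))) : Set (Sph (k + 1)))ᶜ = 0 := by
    rw [hμ]
    simp
  have hsub := halfspaces_subset_of_hasSurfaceArea hPconv hP hPint hμP _ hnull
  obtain ⟨ι, hι, -, -⟩ := exists_hyperplane_chart (sph_norm u)
  have hw : ι (EuclideanSpace.single ⟨0, hk⟩ 1) ≠ 0 := by
    intro h
    have := congrArg norm h
    simp at this
  obtain ⟨a, ha, hpos⟩ := exists_inner_pos_of_halfspaces_subset hP.isBounded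
    (hPint.mono interior_subset) _ (fun x hx u _ => inner_le_supportFn hP hx u) hsub hw
  have h0 := hι (EuclideanSpace.single ⟨0, hk⟩ 1)
  rcases Finset.mem_insert.1 ha with rfl | ha
  · exact absurd hpos (by rw [h0]; exact lt_irrefl 0)
  · rw [Finset.mem_singleton.1 ha, huu, inner_neg_right, h0, neg_zero] at hpos
    exact absurd hpos (lt_irrefl 0)

theorem surfaceArea_ne_zero {k : ℕ} {P : Set (En (k + 1))} {μ : Measure (Sph (k + 1))}
    (hPconv : Convex ℝ P) (hP : IsCompact P) (hPint : (interior P).Nonempty)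
    (hμP : HasSurfaceArea P μ) : μ ≠ 0 := by
  rintro rfl
  have hsub := halfspaces_subset_of_hasSurfaceArea hPconv hP hPint hμP ∅ (by simp)
  obtain ⟨a, ha, -⟩ := exists_inner_pos_of_halfspaces_subset hP.isBounded
    (hPint.mono interior_subset) ∅ (fun x hx u _ => inner_le_supportFn hP hx u) hsub
    (w := EuclideanSpace.single 0 1) (by simp)
  simp at ha

/-- The low order moments of the surface area measure of a polytope determine that measure. -/
theorem surfaceArea_eq_of_moments_eq {k m : ℕ} (hm : k + 1 + 1 ≤ m) {P : Set (En (k + 1))}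
    (hPconv : Convex ℝ P) (hP : IsCompact P) (hPint : (interior P).Nonempty)
    (v : Fin m → En (k + 1)) (c : Fin m → ℝ) (hPv : P = ⋂ j, {x | ⟪x, v j⟫_ℝ ≤ c j})
    {μP μK : Measure (Sph (k + 1))} (hμP : HasSurfaceArea P μP)
    (hmom : ∀ i : Fin (k + 1) → ℕ, (∑ j, i j) ≤ m - (k + 1) + 2 →
      sphMoment μK i = sphMoment μP i) :
    ∃ U : Finset (Sph (k + 1)), μP (U : Set (Sph (k + 1)))ᶜ = 0 ∧ IsFiniteMeasure μP ∧
      μK = μP := by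
  have hPne : P.Nonempty := hPint.mono interior_subset
  obtain ⟨U, hUm, hsub⟩ := exists_support_directions hPne v c hPv
  have hUnull := surfaceArea_compl_eq_zero hP hμP U hsub
  have hfin := isFiniteMeasure_of_hasSurfaceArea hP hμP U hUnull
  have hfinK : IsFiniteMeasure μK := by
    refine ⟨lt_top_iff_ne_top.2 fun htop => ?_⟩
    have h0 := hmom 0 (by simp)
    simp only [sphMoment, Pi.zero_apply, pow_zero, Finset.prod_const_one, integral_const,
      smul_eq_mul, mul_one, measureReal_def, htop, ENNReal.toReal_top] at h0
    rcases (ENNReal.toReal_eq_zero_iff _).1 h0.symm with h | h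
    · exact surfaceArea_ne_zero hPconv hP hPint hμP (Measure.measure_univ_eq_zero.1 h)
    · exact measure_ne_top _ _ h
  have hspan := affineSpan_eq_top_of_halfspaces_subset hP.isBounded hPne U
    (fun x hx u _ => inner_le_supportFn hP hx u) hsub (Nat.succ_pos k)
  exact ⟨U, hUnull, hfin, eq_of_moments_eq hm U hUm hspan hUnull hmom⟩

theorem surfaceArea_real_singleton {k : ℕ} {K : Set (En (k + 1))} {μ : Measure (Sph (k + 1))}
    (hK : IsCompact K) (hμ : HasSurfaceArea K μ) (u : Sph (k + 1)) (ι : En k →ₗᵢ[ℝ] En (k + 1))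
    (hdec : ∀ x, ∃ w, x = ⟪x, (u : En (k + 1))⟫_ℝ • (u : En (k + 1)) + ι w) :
    μ.real {u} = (hausdorffRatio k).toReal *
      volume.real {w | supportFn K u • (u : En (k + 1)) + ι w ∈ face K u} := by
  rw [measureReal_def, measure_singleton_of_hasSurfaceArea hK hμ,
    hausdorffMeasure_of_subset_hyperplane ι hdec fun x hx => hx.2, ENNReal.toReal_mul]
  rfl

theorem lintegral_div_pow {k : ℕ} {h : ℝ} (hh : 0 < h) :
    ∫⁻ σ in Set.Ioo 0 h, ENNReal.ofReal ((σ / h) ^ k) = ENNReal.ofReal (h / (k + 1)) := by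
  rw [← ofReal_integral_eq_lintegral_ofReal]
  · congr 1
    rw [← integral_Ioc_eq_integral_Ioo, ← intervalIntegral.integral_of_le hh.le]
    simp only [div_pow]
    rw [intervalIntegral.integral_div, integral_pow]
    field_simp
    simp
    ring
  · exact ((by fun_prop : Continuous fun σ : ℝ => (σ / h) ^ k).integrableOn_Icc).mono_set
      Set.Ioo_subset_Icc_self
  · filter_upwards [ae_restrict_mem measurableSet_Ioo] with σ hσ
    exact pow_nonneg (div_nonneg hσ.1.le hh.le) k

/-- A set containing the open cone over `G` at height `h` has volume at least that of the cone. -/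
theorem cone_volume_le {k : ℕ} {u : En (k + 1)} {ι : En k →ₗᵢ[ℝ] En (k + 1)}
    (hψ : MeasurePreserving (fun p : ℝ × En k => p.1 • u + ι p.2)) {C : Set (En (k + 1))}
    (hC : MeasurableSet C) {G : Set (En k)} {h : ℝ} (hh : 0 < h)
    (hG : ∀ w ∈ G, ∀ r ∈ Set.Ioo (0 : ℝ) 1, r • (h • u + ι w) ∈ C) :
    ENNReal.ofReal (h / (k + 1)) * volume G ≤ volume C := by
  rw [← hψ.measure_preimage hC.nullMeasurableSet, Measure.volume_eq_prod,
    Measure.prod_apply (hψ.measurable hC), ← lintegral_div_pow hh, ← lintegral_mul_const]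
  · refine le_trans ?_ (setLIntegral_le_lintegral (Set.Ioo 0 h) _)
    refine setLIntegral_mono' measurableSet_Ioo fun σ hσ => ?_
    have h1 := Measure.addHaar_smul_of_nonneg (volume : Measure (En k))
      (div_nonneg hσ.1.le hh.le) G
    rw [finrank_euclideanSpace_fin] at h1
    rw [← h1]
    refine measure_mono ?_
    rintro _ ⟨w, hw, rfl⟩
    have h2 := hG w hw (σ / h) ⟨div_pos hσ.1 hh, (div_lt_one hh).2 hσ.2⟩
    rw [smul_add, smul_smul, div_mul_cancel₀ _ hh.ne', ← map_smul] at h2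
    exact h2
  · fun_prop

theorem sum_surfaceArea_mul_supportFn_le {k : ℕ} {A : Set (En (k + 1))}
    {μ : Measure (Sph (k + 1))} (hAconv : Convex ℝ A) (hA : IsCompact A) (h0 : 0 ∈ interior A)
    (hμ : HasSurfaceArea A μ) (U : Finset (Sph (k + 1))) :
    ∑ u ∈ U, μ.real {u} * supportFn A u ≤
      (hausdorffRatio k).toReal * ((k + 1) * volume.real A) := by
  classical
  have hpos : ∀ u : Sph (k + 1), 0 < supportFn A u := fun u => by
    have := inner_lt_supportFn_of_mem_interior hA (sph_ne_zero u) h0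
    rwa [inner_zero_left] at this
  let C : Sph (k + 1) → Set (En (k + 1)) := fun u => A ∩ ({x | 0 < ⟪x, (u : En (k + 1))⟫_ℝ} ∩
    ⋂ u' ∈ U.erase u, {x | ⟪x, (u' : En (k + 1))⟫_ℝ / supportFn A u' <
      ⟪x, (u : En (k + 1))⟫_ℝ / supportFn A u})
  have hCmeas : ∀ u, MeasurableSet (C u) := fun u =>
    hA.measurableSet.inter ((isOpen_lt continuous_const (by fun_prop)).inter
      (isOpen_biInter_finset fun u' _ => isOpen_lt (by fun_prop) (by fun_prop))).measurableSet
  have hdisj : (U : Set (Sph (k + 1))).PairwiseDisjoint C := by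
    intro u hu u' hu' huu
    refine Set.disjoint_left.2 fun x hx hx' => ?_
    have h1 := Set.mem_iInter₂.1 hx.2.2 u' (Finset.mem_erase.2 ⟨huu.symm, hu'⟩)
    have h2 := Set.mem_iInter₂.1 hx'.2.2 u (Finset.mem_erase.2 ⟨huu, hu⟩)
    rw [Set.mem_ofPred_eq] at h1 h2
    exact lt_asymm h1 h2
  have hvol : ∑ u ∈ U, volume.real (C u) ≤ volume.real A := by
    rw [← measureReal_biUnion_finset hdisj (fun u _ => hCmeas u)
      (fun u _ => ((measure_mono Set.inter_subset_left).trans_lt hA.measure_lt_top).ne)]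
    exact measureReal_mono (Set.iUnion₂_subset fun u _ => Set.inter_subset_left)
      hA.measure_lt_top.ne
  have hcone : ∀ u ∈ U, μ.real {u} * supportFn A u ≤
      (hausdorffRatio k).toReal * ((k + 1) * volume.real (C u)) := by
    intro u hu
    obtain ⟨ι, hι, hdec, hψ⟩ := exists_hyperplane_chart (sph_norm u)
    rw [surfaceArea_real_singleton hA hμ u ι hdec, mul_assoc]
    refine mul_le_mul_of_nonneg_left ?_ ENNReal.toReal_nonneg
    set F := {w | supportFn A u • (u : En (k + 1)) + ι w ∈ face A u} with hF
    let N := ⋃ u' ∈ U.erase u, {w | supportFn A u • (u : En (k + 1)) + ι w ∈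
      face A (u : En (k + 1)) ∩ face A (u' : En (k + 1))}
    have hN : volume N = 0 := by
      refine (measure_biUnion_null_iff (U.erase u).countable_toSet).2 fun u' hu' => ?_
      have h1 := hausdorffMeasure_face_inter_face hA hμ (Finset.ne_of_mem_erase hu').symm
      rw [hausdorffMeasure_of_subset_hyperplane ι hdec fun x hx => hx.1.2] at h1
      exact (mul_eq_zero.1 h1).resolve_left (hausdorffRatio_ne_zero k)
    have hFN : volume (F \ N) = volume F := measure_sdiff_null hN
    have hle : ENNReal.ofReal (supportFn A u / (k + 1)) * volume (F \ N) ≤ volume (C u) := by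
      refine cone_volume_le hψ (hCmeas u) (hpos u) fun w hw r hr => ?_
      have hwA := hw.1.1
      refine ⟨?_, ?_, Set.mem_iInter₂.2 fun u' hu' => ?_⟩
      · exact hAconv.smul_mem_of_zero_mem (interior_subset h0) hwA ⟨hr.1.le, hr.2.le⟩
      · rw [Set.mem_ofPred_eq, real_inner_smul_left, hw.1.2]
        exact mul_pos hr.1 (hpos u)
      · have hne : ⟪supportFn A u • (u : En (k + 1)) + ι w, (u' : En (k + 1))⟫_ℝ ≠
            supportFn A u' := fun h =>
          hw.2 (Set.mem_iUnion₂.2 ⟨u', hu', hw.1, hwA, h⟩)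
        have hlt := lt_of_le_of_ne (inner_le_supportFn hA hwA (u' : En (k + 1))) hne
        rw [Set.mem_ofPred_eq, real_inner_smul_left, real_inner_smul_left, hw.1.2,
          mul_div_assoc, mul_div_assoc, div_self (hpos u).ne']
        exact mul_lt_mul_of_pos_left ((div_lt_one (hpos u')).2 hlt) hr.1
    rw [hFN] at hle
    have hCfin : volume (C u) ≠ ⊤ :=
      ((measure_mono Set.inter_subset_left).trans_lt hA.measure_lt_top).ne
    have h2 := ENNReal.toReal_mono hCfin hle
    rw [ENNReal.toReal_mul, ENNReal.toReal_ofReal (by have := hpos u; positivity)] at h2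
    have h3 : volume.real F = (volume F).toReal := rfl
    have h4 : volume.real (C u) = (volume (C u)).toReal := rfl
    rw [h3, h4]
    have hk : (0 : ℝ) < k + 1 := by positivity
    calc (volume F).toReal * supportFn A u =
        (k + 1) * (supportFn A u / (k + 1) * (volume F).toReal) := by field_simp
      _ ≤ _ := mul_le_mul_of_nonneg_left h2 hk.le
  calc ∑ u ∈ U, μ.real {u} * supportFn A u ≤
      ∑ u ∈ U, (hausdorffRatio k).toReal * ((k + 1) * volume.real (C u)) :=
        Finset.sum_le_sum hcone
    _ = (hausdorffRatio k).toReal * ((k + 1) * ∑ u ∈ U, volume.real (C u)) := by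
      rw [← Finset.mul_sum, ← Finset.mul_sum]
    _ ≤ _ := by gcongr

/-- Brunn–Minkowski for the combinations `(1 - 2⁻ʲ) A + 2⁻ʲ B` of bodies of equal volume. -/
theorem volume_le_volume_dyadic_combination {n : ℕ} {A B : Set (En n)} (hA : IsCompact A)
    (hB : IsCompact B) (hAconv : Convex ℝ A) (hvol : volume.real B = volume.real A) (j : ℕ) :
    volume.real A ≤ volume.real
      ((fun p : En n × En n => (1 - (2⁻¹ : ℝ) ^ j) • p.1 + ((2⁻¹ : ℝ) ^ j) • p.2) '' A ×ˢ B) := by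
  have hC : ∀ j : ℕ, IsCompact ((fun p : En n × En n =>
      (1 - (2⁻¹ : ℝ) ^ j) • p.1 + ((2⁻¹ : ℝ) ^ j) • p.2) '' A ×ˢ B) := fun j =>
    (hA.prod hB).image (by fun_prop)
  induction j with
  | zero =>
    rcases A.eq_empty_or_nonempty with rfl | ⟨a, ha⟩
    · simp
    · rw [← hvol]
      refine measureReal_mono (fun b hb => ⟨(a, b), ⟨ha, hb⟩, by simp⟩) (hC 0).measure_lt_top.ne
  | succ j ih =>
    have h := volume_mul_volume_le_sq hA (hC j) (hC (j + 1)) ?_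
    · have hA0 : 0 ≤ volume.real A := measureReal_nonneg
      nlinarith [measureReal_nonneg (μ := volume) (s := ((fun p : En n × En n =>
        (1 - (2⁻¹ : ℝ) ^ (j + 1)) • p.1 + ((2⁻¹ : ℝ) ^ (j + 1)) • p.2) '' A ×ˢ B))]
    · rintro x hx _ ⟨⟨a, b⟩, ⟨ha, hb⟩, rfl⟩
      set s : ℝ := 2⁻¹ ^ j with hs
      have hs1 : s ≤ 1 := pow_le_one₀ (by norm_num) (by norm_num)
      have hs0 : 0 ≤ s := by positivity
      have hd : 0 < 1 - s / 2 := by linarith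
      refine ⟨((2⁻¹ / (1 - s / 2)) • x + ((1 - s) / 2 / (1 - s / 2)) • a, b), ⟨?_, hb⟩, ?_⟩
      · refine hAconv hx ha (by positivity) (div_nonneg (by linarith) hd.le) ?_
        rw [← add_div, div_eq_one_iff_eq hd.ne']
        ring
      · have h1 : (2⁻¹ : ℝ) ^ (j + 1) = s / 2 := by rw [pow_succ, hs]; ring
        simp only [h1]
        rw [smul_add, smul_smul, smul_smul, mul_div_cancel₀ _ hd.ne', mul_div_cancel₀ _ hd.ne']
        module

open scoped Pointwise in
/-- The volume of `A + t B` when `t / (1 + t)` is a power of `1 / 2`. -/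
theorem le_volume_add_smul {n : ℕ} {A B : Set (En n)} (hA : IsCompact A)
    (hB : IsCompact B) (hAconv : Convex ℝ A) (hvol : volume.real B = volume.real A) (j : ℕ)
    {t : ℝ} (ht : 0 ≤ t) (htj : t / (1 + t) = 2⁻¹ ^ j) :
    (1 + n * t) * volume.real A ≤
      volume.real ((fun p : En n × En n => p.1 + t • p.2) '' A ×ˢ B) := by
  have h1 := volume_le_volume_dyadic_combination hA hB hAconv hvol j
  have ht1 : 0 < 1 + t := by linarith
  have himg : (fun p : En n × En n => p.1 + t • p.2) '' A ×ˢ B = (1 + t) •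
      ((fun p : En n × En n => (1 - (2⁻¹ : ℝ) ^ j) • p.1 + ((2⁻¹ : ℝ) ^ j) • p.2) '' A ×ˢ B) := by
    rw [← Set.image_smul, Set.image_image]
    refine Set.image_congr fun p _ => ?_
    rw [← htj, smul_add, smul_smul, smul_smul, mul_div_cancel₀ _ ht1.ne']
    have : (1 + t) * (1 - t / (1 + t)) = 1 := by field_simp; ring
    rw [this, one_smul]
  have hsmul : ∀ S : Set (En n), volume.real ((1 + t) • S) = (1 + t) ^ n * volume.real S := by
    intro S
    rw [measureReal_def, Measure.addHaar_smul_of_nonneg _ ht1.le, finrank_euclideanSpace_fin,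
      ENNReal.toReal_mul, ENNReal.toReal_ofReal (by positivity)]
    rfl
  rw [himg, hsmul]
  refine mul_le_mul ?_ h1 measureReal_nonneg (by positivity)
  exact one_add_mul_le_pow (by linarith) n

/-- The volume of a set lying between two hyperplanes is bounded by its width times the volume
of any set containing its sections. -/
theorem volume_le_of_slab {k : ℕ} {u : En (k + 1)} {ι : En k →ₗᵢ[ℝ] En (k + 1)}
    (hψ : MeasurePreserving (fun p : ℝ × En k => p.1 • u + ι p.2)) {S : Set (En (k + 1))}
    (hSm : MeasurableSet S) {G : Set (En k)} {h b : ℝ}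
    (hS : ∀ w, ∀ σ : ℝ, σ • u + ι w ∈ S → σ ∈ Set.Ioc h (h + b) ∧ w ∈ G) :
    volume S ≤ ENNReal.ofReal b * volume G := by
  calc volume S = volume ((fun p : ℝ × En k => p.1 • u + ι p.2) ⁻¹' S) :=
        (hψ.measure_preimage hSm.nullMeasurableSet).symm
    _ ≤ volume (Set.Ioc h (h + b) ×ˢ G) := measure_mono fun p hp => hS p.2 p.1 hp
    _ = _ := by
        rw [Measure.volume_eq_prod, Measure.prod_prod, Real.volume_Ioc, add_sub_cancel_left]

/-- Minkowski's first inequality for bodies of equal volume. -/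
theorem volume_le_sum_surfaceArea_mul_supportFn {k : ℕ} {A B : Set (En (k + 1))}
    {μ : Measure (Sph (k + 1))} (hAconv : Convex ℝ A) (hA : IsCompact A) (h0 : 0 ∈ interior A)
    (hμ : HasSurfaceArea A μ) (U : Finset (Sph (k + 1)))
    (hU : μ (U : Set (Sph (k + 1)))ᶜ = 0) (hB : IsCompact B) (h0B : 0 ∈ B)
    (hvol : volume.real B = volume.real A) :
    (hausdorffRatio k).toReal * ((k + 1) * volume.real A) ≤
      ∑ u ∈ U, μ.real {u} * supportFn B u := by
  have hsub := halfspaces_subset_of_hasSurfaceArea hAconv hA ⟨0, h0⟩ hμ U hU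
  have hb0 : ∀ u : Sph (k + 1), 0 ≤ supportFn B u := fun u => by
    have := inner_le_supportFn hB h0B (u : En (k + 1))
    rwa [inner_zero_left] at this
  choose ι hι hdec hψ using fun u : Sph (k + 1) => exists_hyperplane_chart (sph_norm u)
  obtain ⟨RA, hRA⟩ := hA.isBounded.exists_norm_le
  obtain ⟨RB, hRB⟩ := hB.isBounded.exists_norm_le
  have hRB0 : 0 ≤ RB := (norm_nonneg _).trans (hRB 0 h0B)
  let G : Sph (k + 1) → ℝ → Set (En k) := fun u t => closedBall 0 (2 * (RA + RB)) ∩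
    ⋂ u' ∈ U, {w | ⟪supportFn A u • (u : En (k + 1)) + ι u w, (u' : En (k + 1))⟫_ℝ ≤
      supportFn A u' + t * (supportFn B u' + supportFn B u)}
  have hGcl : ∀ u t, IsClosed (G u t) := fun u t => isClosed_closedBall.inter
    (isClosed_biInter fun u' _ => isClosed_le (by fun_prop) continuous_const)
  have hGfin : ∀ u t, volume (G u t) ≠ ⊤ := fun u t =>
    ((measure_mono Set.inter_subset_left).trans_lt measure_closedBall_lt_top).ne
  have hmain : ∀ (j : ℕ) (t : ℝ), 0 < t → t ≤ 1 → t / (1 + t) = 2⁻¹ ^ j →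
      (k + 1) * volume.real A ≤ ∑ u ∈ U, supportFn B u * volume.real (G u t) := by
    intro j t ht ht1 htj
    set D := (fun p : En (k + 1) × En (k + 1) => p.1 + t • p.2) '' A ×ˢ B with hD
    have hDc : IsCompact D := (hA.prod hB).image (by fun_prop)
    let S : Sph (k + 1) → Set (En (k + 1)) := fun u =>
      D ∩ {z | supportFn A u < ⟪z, (u : En (k + 1))⟫_ℝ}
    have hSm : ∀ u, MeasurableSet (S u) := fun u => hDc.measurableSet.inter
      (isOpen_lt continuous_const (by fun_prop)).measurableSet
    have hDle : ∀ z ∈ D, ∀ u : Sph (k + 1),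
        ⟪z, (u : En (k + 1))⟫_ℝ ≤ supportFn A u + t * supportFn B u := by
      rintro _ ⟨⟨a, b⟩, ⟨ha, hb⟩, rfl⟩ u
      rw [inner_add_left, real_inner_smul_left]
      exact add_le_add (inner_le_supportFn hA ha _)
        (mul_le_mul_of_nonneg_left (inner_le_supportFn hB hb _) ht.le)
    have hDnorm : ∀ z ∈ D, ‖z‖ ≤ RA + RB := by
      rintro _ ⟨⟨a, b⟩, ⟨ha, hb⟩, rfl⟩
      refine (norm_add_le _ _).trans (add_le_add (hRA a ha) ?_)
      rw [norm_smul, Real.norm_of_nonneg ht.le]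
      exact (mul_le_mul ht1 (hRB b hb) (norm_nonneg b) zero_le_one).trans_eq (one_mul RB)
    have hSvol : ∀ u ∈ U, volume.real (S u) ≤ t * (supportFn B u * volume.real (G u t)) := by
      intro u hu
      have hle : volume (S u) ≤ ENNReal.ofReal (t * supportFn B u) * volume (G u t) := by
        refine volume_le_of_slab (hψ u) (hSm u) (h := supportFn A u) ?_
        rintro w σ ⟨hzD, hz⟩
        have hσ : ⟪σ • (u : En (k + 1)) + ι u w, (u : En (k + 1))⟫_ℝ = σ := by
          rw [inner_add_left, real_inner_smul_left, hι, real_inner_self_eq_norm_sq, sph_norm]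
          ring
        have hσ2 := hDle _ hzD u
        rw [Set.mem_ofPred_eq, hσ] at hz
        rw [hσ] at hσ2
        refine ⟨⟨hz, hσ2⟩, ?_, Set.mem_iInter₂.2 fun u' hu' => ?_⟩
        · have h1 := hDnorm _ hzD
          have h2 : |σ| ≤ RA + RB := by
            rw [← hσ]
            refine (abs_real_inner_le_norm _ _).trans ?_
            rwa [sph_norm, mul_one]
          rw [mem_closedBall_zero_iff, ← (ι u).norm_map]
          have h3 := norm_sub_le (σ • (u : En (k + 1)) + ι u w) (σ • (u : En (k + 1)))
          rw [add_sub_cancel_left, norm_smul, sph_norm, Real.norm_eq_abs, mul_one] at h3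
          linarith
        · have h1 := hDle _ hzD u'
          have h2 : -1 ≤ ⟪(u : En (k + 1)), (u' : En (k + 1))⟫_ℝ := by
            have := abs_real_inner_le_norm (u : En (k + 1)) u'
            rw [sph_norm, sph_norm, one_mul] at this
            exact (abs_le.1 this).1
          rw [inner_add_left, real_inner_smul_left] at h1
          rw [Set.mem_ofPred_eq, inner_add_left, real_inner_smul_left]
          have h3 := mul_nonneg (sub_nonneg.2 hz.le) (neg_le_iff_add_nonneg'.1 h2)
          linarith
      have h2 := ENNReal.toReal_mono (ENNReal.mul_ne_top ENNReal.ofReal_ne_top (hGfin u t)) hle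
      rw [ENNReal.toReal_mul, ENNReal.toReal_ofReal (mul_nonneg ht.le (hb0 u)), mul_assoc] at h2
      exact h2
    have hcov : D ⊆ A ∪ ⋃ u ∈ U, S u := by
      intro z hz
      by_cases hzA : z ∈ A
      · exact Or.inl hzA
      · refine Or.inr ?_
        by_contra hcon
        refine hzA (hsub fun u hu => ?_)
        by_contra! hlt
        exact hcon (Set.mem_iUnion₂.2 ⟨u, hu, hz, hlt⟩)
    have hSfin : ∀ u, volume (S u) ≠ ⊤ := fun u =>
      ((measure_mono Set.inter_subset_left).trans_lt hDc.measure_lt_top).ne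
    have h1 := le_volume_add_smul hA hB hAconv hvol j ht.le htj
    have h2 : volume.real D ≤ volume.real A + ∑ u ∈ U, volume.real (S u) := by
      refine (measureReal_mono hcov ?_).trans ((measureReal_union_le _ _).trans
        (add_le_add le_rfl (measureReal_biUnion_finset_le _ _)))
      exact (measure_union_lt_top hA.measure_lt_top
        (measure_biUnion_lt_top U.finite_toSet fun u _ => (hSfin u).lt_top)).ne
    have h3 := Finset.sum_le_sum hSvol
    rw [← Finset.mul_sum] at h3
    have h4 : t * ((k + 1) * volume.real A) ≤
        t * ∑ u ∈ U, supportFn B u * volume.real (G u t) := by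
      push_cast at h1
      linarith
    exact le_of_mul_le_mul_left h4 ht
  have hlim : ∀ u, Tendsto (fun t => volume.real (G u t)) (𝓝[>] 0)
      (𝓝 (volume.real (⋂ t > 0, G u t))) := by
    intro u
    have h1 := tendsto_measure_biInter_gt (μ := (volume : Measure (En k))) (s := G u) (a := 0)
      (fun r _ => (hGcl u r).nullMeasurableSet) ?_ ⟨1, one_pos, hGfin u 1⟩
    · exact (ENNReal.tendsto_toReal ((measure_mono (Set.iInter₂_subset 1 one_pos)).trans_lt
        (hGfin u 1).lt_top).ne).comp h1
    · rintro r r' - hrr w ⟨hw1, hw2⟩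
      refine ⟨hw1, Set.mem_iInter₂.2 fun u' hu' => ?_⟩
      have h2 := Set.mem_iInter₂.1 hw2 u' hu'
      rw [Set.mem_ofPred_eq] at h2 ⊢
      have := mul_le_mul_of_nonneg_right hrr (add_nonneg (hb0 u') (hb0 u))
      linarith
  have hlimle : ∀ u ∈ U, (hausdorffRatio k).toReal * volume.real (⋂ t > 0, G u t) ≤
      μ.real {u} := by
    intro u hu
    rw [surfaceArea_real_singleton hA hμ u (ι u) (hdec u)]
    refine mul_le_mul_of_nonneg_left (measureReal_mono ?_ ?_) ENNReal.toReal_nonneg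
    · intro w hw
      refine ⟨hsub fun u' hu' => ?_, ?_⟩
      · have hc : Tendsto (fun t : ℝ => supportFn A u' + t * (supportFn B u' + supportFn B u))
            (𝓝[>] 0) (𝓝 (supportFn A u')) := by
          have : Continuous fun t : ℝ =>
            supportFn A u' + t * (supportFn B u' + supportFn B u) := by fun_prop
          have h := this.tendsto 0
          simp only [zero_mul, add_zero] at h
          exact h.mono_left nhdsWithin_le_nhds
        refine ge_of_tendsto hc ?_
        filter_upwards [self_mem_nhdsWithin] with t ht
        exact Set.mem_iInter₂.1 (Set.mem_iInter₂.1 hw t ht).2 u' hu'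
      · rw [inner_add_left, real_inner_smul_left, hι, real_inner_self_eq_norm_sq, sph_norm]
        ring
    · have hiso : Isometry (fun w => supportFn A u • (u : En (k + 1)) + ι u w) :=
        (IsometryEquiv.addLeft (supportFn A u • (u : En (k + 1)))).isometry.comp (ι u).isometry
      exact (hiso.antilipschitz.isBounded_preimage
        (isCompact_face hA (u : En (k + 1))).isBounded).measure_lt_top.ne
  have hs : Tendsto (fun j : ℕ => (2⁻¹ : ℝ) ^ (j + 1)) atTop (𝓝 0) :=
    (tendsto_pow_atTop_nhds_zero_of_lt_one (by norm_num) (by norm_num)).comp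
      (tendsto_add_atTop_nat 1)
  have hs2 : ∀ j : ℕ, (2⁻¹ : ℝ) ^ (j + 1) ≤ 2⁻¹ := fun j =>
    pow_le_of_le_one (by norm_num) (by norm_num) (Nat.succ_ne_zero j)
  have hs0 : ∀ j : ℕ, 0 < (2⁻¹ : ℝ) ^ (j + 1) := fun j => by positivity
  have hfrac : ∀ s : ℝ, s ≤ 2⁻¹ → s / (1 - s) / (1 + s / (1 - s)) = s := by
    intro s hs
    have h1 : 1 - s ≠ 0 := by linarith
    have h2 : 1 + s / (1 - s) = 1 / (1 - s) := by
      field_simp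
      ring
    rw [h2]
    field_simp
  have htend : Tendsto (fun j : ℕ => (2⁻¹ : ℝ) ^ (j + 1) / (1 - 2⁻¹ ^ (j + 1))) atTop
      (𝓝[>] 0) := by
    refine tendsto_nhdsWithin_iff.2 ⟨?_, .of_forall fun j => ?_⟩
    · have h := hs.div (tendsto_const_nhds.sub hs) (by norm_num : (1 : ℝ) - 0 ≠ 0)
      rw [zero_div] at h
      exact h
    · exact div_pos (hs0 j) (by linarith [hs2 j])
  have hfinal : (k + 1) * volume.real A ≤
      ∑ u ∈ U, supportFn B u * volume.real (⋂ t > 0, G u t) := by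
    have h1 : Tendsto (fun t => ∑ u ∈ U, supportFn B u * volume.real (G u t)) (𝓝[>] 0)
        (𝓝 (∑ u ∈ U, supportFn B u * volume.real (⋂ t > 0, G u t))) :=
      tendsto_finsetSum _ fun u _ => (hlim u).const_mul _
    refine ge_of_tendsto' (h1.comp htend) fun j => hmain (j + 1) _ ?_ ?_ ?_
    · exact div_pos (hs0 j) (by linarith [hs2 j])
    · rw [div_le_one (by linarith [hs2 j])]
      linarith [hs2 j]
    · exact hfrac _ (hs2 j)
  calc (hausdorffRatio k).toReal * ((k + 1) * volume.real A) ≤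
      (hausdorffRatio k).toReal * ∑ u ∈ U, supportFn B u * volume.real (⋂ t > 0, G u t) :=
        mul_le_mul_of_nonneg_left hfinal ENNReal.toReal_nonneg
    _ = ∑ u ∈ U, (hausdorffRatio k).toReal * volume.real (⋂ t > 0, G u t) * supportFn B u := by
        rw [Finset.mul_sum]
        exact Finset.sum_congr rfl fun u _ => by ring
    _ ≤ _ := Finset.sum_le_sum fun u hu => mul_le_mul_of_nonneg_right (hlimle u hu) (hb0 u)

theorem reverseGauss_image_add {n : ℕ} (K : Set (En n)) (a : En n) (ω : Set (Sph n)) :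
    reverseGauss ((fun y => y + a) '' K) ω = (fun y => y + a) '' reverseGauss K ω := by
  have hfr : frontier ((fun y => y + a) '' K) = (fun y => y + a) '' frontier K :=
    ((Homeomorph.addRight a).image_frontier K).symm
  ext x
  simp only [reverseGauss, hfr, Set.mem_ofPred_eq]
  constructor
  · rintro ⟨⟨z, hz, rfl⟩, u, hu, h⟩
    refine ⟨z, ⟨hz, u, hu, fun y hy => ?_⟩, rfl⟩
    simpa using h _ ⟨y, hy, rfl⟩
  · rintro ⟨z, ⟨hz, u, hu, h⟩, rfl⟩
    refine ⟨⟨z, hz, rfl⟩, u, hu, ?_⟩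
    rintro _ ⟨y, hy, rfl⟩
    simpa using h y hy

theorem HasSurfaceArea.image_add {k : ℕ} {K : Set (En (k + 1))} {μ : Measure (Sph (k + 1))}
    (hμ : HasSurfaceArea K μ) (a : En (k + 1)) : HasSurfaceArea ((fun y => y + a) '' K) μ := by
  intro ω hω
  rw [hμ ω hω, reverseGauss_image_add]
  exact ((IsometryEquiv.addRight a).isometry.hausdorffMeasure_image
    (Or.inl (Nat.cast_nonneg k)) _).symm

theorem zero_mem_interior_image_add_neg {n : ℕ} {K : Set (En n)} {p : En n}
    (hp : p ∈ interior K) : 0 ∈ interior ((fun y => y + -p) '' K) := by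
  have : interior ((fun y => y + -p) '' K) = (fun y => y + -p) '' interior K :=
    ((Homeomorph.addRight (-p)).image_interior K).symm
  rw [this]
  exact ⟨p, hp, by simp⟩

open scoped Pointwise in
theorem supportFn_smul_le {n : ℕ} {B : Set (En n)} (hB : IsCompact B) (hne : B.Nonempty) {r : ℝ}
    (hr : 0 ≤ r) (u : En n) : supportFn (r • B) u ≤ r * supportFn B u := by
  refine supportFn_le hne.smul_set ?_
  rintro _ ⟨x, hx, rfl⟩
  simp only [inner_smul_left, RCLike.conj_to_real]
  exact mul_le_mul_of_nonneg_left (inner_le_supportFn hB hx u) hr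

open scoped Pointwise in
/-- A homogeneous form of Minkowski's first inequality for polytopes. -/
theorem exists_pos_scale_volume_le {k : ℕ} {A B : Set (En (k + 1))}
    {μ : Measure (Sph (k + 1))} (hAconv : Convex ℝ A) (hA : IsCompact A) (h0 : 0 ∈ interior A)
    (hμ : HasSurfaceArea A μ) (U : Finset (Sph (k + 1)))
    (hU : μ (U : Set (Sph (k + 1)))ᶜ = 0) (hAv : 0 < volume.real A) (hB : IsCompact B)
    (h0B : 0 ∈ B) (hBv : 0 < volume.real B) :
    ∃ r : ℝ, 0 < r ∧ r ^ (k + 1) * volume.real B = volume.real A ∧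
      (hausdorffRatio k).toReal * ((k + 1) * volume.real A) ≤
        r * ∑ u ∈ U, μ.real {u} * supportFn B u := by
  have hq : 0 < volume.real A / volume.real B := div_pos hAv hBv
  set r := (volume.real A / volume.real B) ^ (((k + 1 : ℕ) : ℝ)⁻¹) with hr
  have hr0 : 0 < r := Real.rpow_pos_of_pos hq _
  have hrp : r ^ (k + 1) = volume.real A / volume.real B :=
    Real.rpow_inv_natCast_pow hq.le (by omega)
  have hvol : volume.real (r • B) = volume.real A := by
    rw [measureReal_def, Measure.addHaar_smul_of_nonneg _ hr0.le, ENNReal.toReal_mul,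
      ENNReal.toReal_ofReal (by positivity), finrank_euclideanSpace_fin, ← measureReal_def, hrp,
      div_mul_cancel₀ _ hBv.ne']
  refine ⟨r, hr0, by rw [hrp, div_mul_cancel₀ _ hBv.ne'], ?_⟩
  refine (volume_le_sum_surfaceArea_mul_supportFn hAconv hA h0 hμ U hU (hB.smul r)
    ⟨0, h0B, smul_zero r⟩ hvol).trans ?_
  rw [Finset.mul_sum]
  refine Finset.sum_le_sum fun u _ => ?_
  rw [mul_left_comm]
  exact mul_le_mul_of_nonneg_left (supportFn_smul_le hB ⟨0, h0B⟩ hr0.le _) measureReal_nonneg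

theorem hausdorffRatio_toReal_pos (k : ℕ) : 0 < (hausdorffRatio k).toReal :=
  ENNReal.toReal_pos (hausdorffRatio_ne_zero k) (hausdorffRatio_ne_top k)

theorem volume_real_pos {n : ℕ} {K : Set (En n)} (hK : IsCompact K)
    (hint : (interior K).Nonempty) : 0 < volume.real K :=
  ENNReal.toReal_pos (Measure.measure_pos_of_nonempty_interior _ hint).ne' hK.measure_lt_top.ne

theorem volume_le_of_common_surfaceArea {k : ℕ} (hk : 1 ≤ k) {A B : Set (En (k + 1))}
    {μ : Measure (Sph (k + 1))} (hAconv : Convex ℝ A) (hA : IsCompact A) (hA0 : 0 ∈ interior A)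
    (hBconv : Convex ℝ B) (hB : IsCompact B) (hB0 : 0 ∈ interior B)
    (hμA : HasSurfaceArea A μ) (hμB : HasSurfaceArea B μ) (U : Finset (Sph (k + 1)))
    (hU : μ (U : Set (Sph (k + 1)))ᶜ = 0) : volume.real A ≤ volume.real B := by
  have hAv := volume_real_pos hA ⟨0, hA0⟩
  have hBv := volume_real_pos hB ⟨0, hB0⟩
  obtain ⟨r, hr0, hr, h1⟩ := exists_pos_scale_volume_le hAconv hA hA0 hμA U hU hAv hB
    (interior_subset hB0) hBv
  have h2 := sum_surfaceArea_mul_supportFn_le hBconv hB hB0 hμB U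
  have hκ := hausdorffRatio_toReal_pos k
  have h3 := h1.trans (mul_le_mul_of_nonneg_left h2 hr0.le)
  have hc : 0 < (hausdorffRatio k).toReal * ((k + 1) * volume.real B) * r := by positivity
  rw [← hr] at h3
  have h4 : r ^ k ≤ 1 := by
    refine le_of_mul_le_mul_left ?_ hc
    calc _ = (hausdorffRatio k).toReal * ((k + 1) * (r ^ (k + 1) * volume.real B)) := by ring
      _ ≤ _ := h3
      _ = _ := by ring
  have h5 : r ≤ 1 := (pow_le_one_iff_of_nonneg hr0.le (by omega)).1 h4
  rw [← hr]
  exact mul_le_of_le_one_left hBv.le (pow_le_one₀ hr0.le h5)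

/-- Uniqueness in Minkowski's theorem for discrete surface area measures. -/
theorem exists_eq_image_add_of_common_surfaceArea {k : ℕ} (hk : 1 ≤ k) {A B : Set (En (k + 1))}
    {μ : Measure (Sph (k + 1))} (hAconv : Convex ℝ A) (hA : IsCompact A) (hA0 : 0 ∈ interior A)
    (hBconv : Convex ℝ B) (hB : IsCompact B) (hB0 : 0 ∈ interior B)
    (hμA : HasSurfaceArea A μ) (hμB : HasSurfaceArea B μ) (U : Finset (Sph (k + 1)))
    (hU : μ (U : Set (Sph (k + 1)))ᶜ = 0) : ∃ x, B = (fun y => y + x) '' A := by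
  have hv := volume_real_pos hA ⟨0, hA0⟩
  have hBA : volume.real B = volume.real A := le_antisymm
    (volume_le_of_common_surfaceArea hk hBconv hB hB0 hAconv hA hA0 hμB hμA U hU)
    (volume_le_of_common_surfaceArea hk hAconv hA hA0 hBconv hB hB0 hμA hμB U hU)
  set M : Set (En (k + 1)) :=
    (fun p : En (k + 1) × En (k + 1) => (2⁻¹ : ℝ) • (p.1 + p.2)) '' B ×ˢ A with hMdef
  have hM : IsCompact M := (hB.prod hA).image (by fun_prop)
  have hmid : ∀ x ∈ B, ∀ y ∈ A, (2⁻¹ : ℝ) • (x + y) ∈ M := fun x hx y hy => ⟨(x, y), ⟨hx, hy⟩, rfl⟩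
  have h0M : (0 : En (k + 1)) ∈ M := by
    simpa using hmid 0 (interior_subset hB0) 0 (interior_subset hA0)
  have hge : volume.real A ≤ volume.real M := by
    have := volume_mul_volume_le_sq hB hA hM hmid
    rw [hBA, ← sq] at this
    exact (pow_le_pow_iff_left₀ hv.le measureReal_nonneg two_ne_zero).1 this
  have hMv := hv.trans_le hge
  have hsupp : ∀ u : Sph (k + 1), supportFn M u ≤ 2⁻¹ * (supportFn B u + supportFn A u) := by
    intro u
    refine supportFn_le ⟨0, h0M⟩ ?_
    rintro _ ⟨⟨x, y⟩, ⟨hx, hy⟩, rfl⟩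
    have h1 := inner_le_supportFn hB hx (u : En (k + 1))
    have h2 := inner_le_supportFn hA hy (u : En (k + 1))
    simp only [inner_smul_left, inner_add_left, RCLike.conj_to_real]
    linarith
  have hsum : ∑ u ∈ U, μ.real {u} * supportFn M u ≤
      (hausdorffRatio k).toReal * ((k + 1) * volume.real A) := by
    have h1 := sum_surfaceArea_mul_supportFn_le hAconv hA hA0 hμA U
    have h2 := sum_surfaceArea_mul_supportFn_le hBconv hB hB0 hμB U
    rw [hBA] at h2
    calc ∑ u ∈ U, μ.real {u} * supportFn M u
        ≤ ∑ u ∈ U, μ.real {u} * (2⁻¹ * (supportFn B u + supportFn A u)) :=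
          Finset.sum_le_sum fun u _ => mul_le_mul_of_nonneg_left (hsupp u) measureReal_nonneg
      _ = 2⁻¹ * (∑ u ∈ U, μ.real {u} * supportFn B u + ∑ u ∈ U, μ.real {u} * supportFn A u) := by
          rw [← Finset.sum_add_distrib, Finset.mul_sum]
          exact Finset.sum_congr rfl fun u _ => by ring
      _ ≤ _ := by linarith
  obtain ⟨r, hr0, hr, hle⟩ := exists_pos_scale_volume_le hAconv hA hA0 hμA U hU hv hM h0M hMv
  have hκ := hausdorffRatio_toReal_pos k
  have hr1 : 1 ≤ r := by
    have h3 := hle.trans (mul_le_mul_of_nonneg_left hsum hr0.le)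
    have hc : 0 < (hausdorffRatio k).toReal * ((k + 1) * volume.real A) := by positivity
    exact le_of_mul_le_mul_right (by rwa [one_mul]) hc
  have hMA : volume.real M = volume.real A := by
    refine le_antisymm ?_ hge
    rw [← hr]
    exact le_mul_of_one_le_left hMv.le (one_le_pow₀ hr1)
  have hcl : ∀ {S : Set (En (k + 1))}, Convex ℝ S → 0 ∈ interior S → S ⊆ closure (interior S) := by
    intro S hS h0
    rw [hS.closure_interior_eq_closure_of_nonempty_interior ⟨0, h0⟩]
    exact subset_closure
  exact exists_eq_image_add_of_volume_midpoint hB hA hM (hcl hBconv hB0) (hcl hAconv hA0) hmid hv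
    hBA rfl hMA

/-- a polytope `P ⊆ ℝⁿ` with nonempty interior and at most `m`
facets (`m ≥ n+1`), i.e. a compact intersection of `m` closed halfspaces, is
uniquely determined up to translation among all convex bodies by its surface
tensors up to rank `m - n + 2`; equality of surface tensors up to that rank is
expressed by equality of the moments of the surface area measures up to order
`m - n + 2`. -/
theorem stmt3 {n : ℕ} (hn : 2 ≤ n) (m : ℕ) (hm : n + 1 ≤ m)
    (P : Set (En n)) (hPconv : Convex ℝ P) (hPcomp : IsCompact P)
    (hPint : (interior P).Nonempty)
    (v : Fin m → En n) (c : Fin m → ℝ)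
    (hPfacets : P = ⋂ j, {x : En n | ⟪x, v j⟫_ℝ ≤ c j})
    (K : Set (En n)) (hKconv : Convex ℝ K) (hKcomp : IsCompact K) (hKne : K.Nonempty)
    (μP μK : Measure (Sph n))
    (hμP : IsSurfaceAreaMeasure P μP) (hμK : IsSurfaceAreaMeasure K μK)
    (hmom : ∀ i : Fin n → ℕ, (∑ j, i j) ≤ m - n + 2 → sphMoment μK i = sphMoment μP i) :
    ∃ x : En n, K = (fun y => y + x) '' P := by
  obtain ⟨k, rfl⟩ : ∃ k, n = k + 1 := ⟨n - 1, by omega⟩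
  have hk : 1 ≤ k := by omega
  have hP := hμP.hasSurfaceArea hPint
  obtain ⟨U, hU, -, rfl⟩ := surfaceArea_eq_of_moments_eq hm hPconv hPcomp hPint v c hPfacets hP hmom
  have hKint := interior_nonempty_of_common_surfaceArea hk hPconv hPcomp hPint hP hμK
  have hK := hμK.hasSurfaceArea hKint
  obtain ⟨p, hp⟩ := hPint
  obtain ⟨q, hq⟩ := hKint
  obtain ⟨x, hx⟩ := exists_eq_image_add_of_common_surfaceArea hk
    (A := (fun y => y + -p) '' P) (B := (fun y => y + -q) '' K)
    (by simpa only [add_comm] using hPconv.translate (-p)) (hPcomp.image (by fun_prop))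
    (zero_mem_interior_image_add_neg hp) (by simpa only [add_comm] using hKconv.translate (-q))
    (hKcomp.image (by fun_prop)) (zero_mem_interior_image_add_neg hq) (hP.image_add _)
    (hK.image_add _) U hU
  refine ⟨-p + x + q, ?_⟩
  have := congrArg (fun S => (fun y => y + q) '' S) hx
  simpa only [Set.image_image, add_assoc, neg_add_cancel, add_zero, Set.image_id'] using this
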